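/- arXiv:1106.5204 — 2 statements merged into one kernel-verified Lean document; each statement's English description precedes it below -/
import Mathlib

section
/- The infinite word w contains no additive cube: for all i ∈ ℕ and all n ≥ 1, it is NOT the case that ∑_{j<n} w(i+j) = ∑_{j<n} w(i+n+j) and ∑_{j<n} w(i+n+j) = ∑_{j<n} w(i+2n+j). -/
/-- The morphism φ on letters: φ(0)=03, φ(1)=43, φ(3)=1, φ(4)=01. -/
def phiLetter : ℕ → List ℕ
  | 0 => [0, 3]
  | 1 => [4, 3]
  | 3 => [1]
  | 4 => [0, 1]
  | _ => []

/-- The morphism φ on words, applied letterwise and concatenated. -/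
def phi (x : List ℕ) : List ℕ := x.flatMap phiLetter

/-- The fixed point `w` of φ beginning with 0: `w n` is the `n`-th letter of
`φ^k([0])` for any `k` with `|φ^k([0])| > n` (e.g. `k = n+1` works). -/
def w (n : ℕ) : ℕ := (phi^[n + 1] [0]).getD n 0

namespace AddCube

noncomputable section

/-! ### Search trees of natural numbers, used as finite sets of codes -/

/-- Binary trees with keys in `ℕ`. -/
inductive KT : Type
  | o : KT
  | t : KT → ℕ → KT → KT

namespace KT

/-- A one-element tree. -/
abbrev s (k : ℕ) : KT := t o k o

/-- Search for a key. -/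
def mem (T : KT) : ℕ → Bool :=
  KT.rec (fun _ => false)
    (fun _ k _ ihl ihr x =>
      bif Nat.beq x k then true else bif Nat.ble x k then ihl x else ihr x) T

/-- All keys satisfy `p`. -/
def all (p : ℕ → Bool) (T : KT) : Bool :=
  KT.rec true (fun _ k _ ihl ihr => bif p k then (bif ihl then ihr else false) else false) T

theorem all_of_mem (p : ℕ → Bool) (T : KT) (x : ℕ) (hm : mem T x = true)
    (ha : all p T = true) : p x = true := by
  induction T with
  | o => simp [mem] at hm
  | t l k r ihl ihr =>
    have ha' : (bif p k then (bif all p l then all p r else false) else false) = true := ha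
    have hm' : (bif Nat.beq x k then true else bif Nat.ble x k then mem l x else mem r x) = true :=
      hm
    cases hk : p k
    · simp [hk] at ha'
    · cases hl : all p l
      · simp [hk, hl] at ha'
      · simp only [hk, hl, cond_true] at ha'
        cases hb : Nat.beq x k
        · cases hle : Nat.ble x k
          · simp only [hb, hle, cond_false] at hm'
            exact ihr hm' ha'
          · simp only [hb, hle, cond_false, cond_true] at hm'
            exact ihl hm' hl
        · rw [Nat.eq_of_beq_eq_true hb]
          exact hk

noncomputable def treeU : KT :=
  (t (t (t (t (t (t (t (t
(t (t (s 10332) 10587 o) 10602 (t (s 10603) 10604 o)) 10618 (t (t (s 10619) 10620 o) 10842 (t (s 14412) 14427 o))) 14428 (t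
(t (t (s 14429) 14443 o) 14444 (t (s 14445) 14458 o)) 14459 (t (t (s 14460) 14474 o) 14475 (t (s 14489) 14490 o)))) 14651 (t (t
(t (t (s 14667) 14668 o) 14682 (t (s 14683) 14684 o)) 14698 (t (t (s 14699) 14700 o) 14701 (t (s 14713) 14714 o))) 14715 (t
(t (t (s 14716) 14717 o) 14729 (t (s 14730) 14731 o)) 14732 (t (t (s 14746) 14747 o) 14891 (t (s 14907) 14922 o))))) 14923 (t (t (t
(t (t (s 14938) 14939 o) 14940 (t (s 14953) 14954 o)) 14955 (t (t (s 14956) 14969 o) 14970 (t (s 14971) 14972 o))) 14986 (t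
(t (t (s 14987) 14988 o) 15162 (t (s 15163) 15178 o)) 15179 (t (t (s 15193) 15194 o) 15195 (t (s 15209) 15210 o)))) 15211 (t (t
(t (t (s 15227) 15434 o) 15450 (t (s 18252) 18268 o)) 18491 (t (t (s 18507) 18508 o) 18522 (t (s 18523) 18524 o))) 18525 (t
(t (t (s 18538) 18539 o) 18540 (t (s 18553) 18554 o)) 18555 (t (t (s 18556) 18569 o) 18570 (t (s 18571) 18572 o)))))) 18584 (t (t (t (t
(t (t (s 18585) 18586 o) 18600 (t (s 18601) 18602 o)) 18617 (t (t (s 18731) 18747 o) 18762 (t (s 18763) 18764 o))) 18778 (t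
(t (t (s 18779) 18780 o) 18781 (t (s 18793) 18794 o)) 18795 (t (t (s 18796) 18809 o) 18810 (t (s 18811) 18812 o)))) 18824 (t (t
(t (t (s 18825) 18826 o) 18827 (t (s 18840) 18841 o)) 18842 (t (t (s 18843) 18857 o) 18858 (t (s 18859) 18874 o))) 18987 (t
(t (t (s 19002) 19003 o) 19018 (t (s 19019) 19020 o)) 19033 (t (t (s 19034) 19035 o) 19036 (t (s 19049) 19050 o))))) 19051 (t (t (t
(t (t (s 19052) 19064 o) 19065 (t (s 19066) 19067 o)) 19068 (t (t (s 19079) 19080 o) 19081 (t (s 19082) 19083 o))) 19097 (t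
(t (t (s 19098) 19099 o) 19114 (t (s 19243) 19259 o)) 19274 (t (t (s 19275) 19276 o) 19289 (t (s 19290) 19291 o)))) 19292 (t (t
(t (t (s 19305) 19306 o) 19307 (t (s 19308) 19320 o)) 19321 (t (t (s 19322) 19323 o) 19336 (t (s 19337) 19338 o))) 19339 (t
(t (t (s 19354) 19515 o) 19530 (t (s 19531) 19545 o)) 19546 (t (t (s 19547) 19561 o) 19562 (t (s 19563) 19576 o))))))) 19577 (t (t (t (t (t
(t (t (s 19578) 19594 o) 20072 (t (s 20282) 22347 o)) 22348 (t (t (s 22363) 22364 o) 22365 (t (s 22378) 22379 o))) 22380 (t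
(t (t (s 22394) 22395 o) 22409 (t (s 22410) 22425 o)) 22587 (t (t (s 22602) 22603 o) 22604 (t (s 22618) 22619 o)))) 22620 (t (t
(t (t (s 22621) 22633 o) 22634 (t (s 22635) 22636 o)) 22649 (t (t (s 22650) 22651 o) 22664 (t (s 22665) 22666 o))) 22667 (t
(t (t (s 22679) 22680 o) 22681 (t (s 22682) 22695 o)) 22696 (t (t (s 22697) 22698 o) 22712 (t (s 22713) 22714 o))))) 22729 (t (t (t
(t (t (s 22827) 22842 o) 22843 (t (s 22858) 22859 o)) 22860 (t (t (s 22873) 22874 o) 22875 (t (s 22876) 22877 o))) 22888 (t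
(t (t (s 22889) 22890 o) 22891 (t (s 22892) 22904 o)) 22905 (t (t (s 22906) 22907 o) 22908 (t (s 22919) 22920 o)))) 22921 (t (t
(t (t (s 22922) 22923 o) 22935 (t (s 22936) 22937 o)) 22938 (t (t (s 22951) 22952 o) 22953 (t (s 22954) 22968 o))) 22969 (t
(t (t (s 23083) 23098 o) 23099 (t (s 23114) 23115 o)) 23116 (t (t (s 23129) 23130 o) 23131 (t (s 23132) 23144 o)))))) 23145 (t (t (t (t
(t (t (s 23146) 23147 o) 23148 (t (s 23160) 23161 o)) 23162 (t (t (s 23163) 23175 o) 23176 (t (s 23177) 23178 o))) 23179 (t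
(t (t (s 23191) 23192 o) 23193 (t (s 23194) 23208 o)) 23209 (t (t (s 23225) 23339 o) 23354 (t (s 23355) 23370 o)))) 23371 (t (t
(t (t (s 23372) 23385 o) 23386 (t (s 23387) 23388 o)) 23400 (t (t (s 23401) 23402 o) 23403 (t (s 23416) 23417 o))) 23418 (t
(t (t (s 23419) 23431 o) 23432 (t (s 23433) 23434 o)) 23448 (t (t (s 23449) 23465 o) 23642 (t (s 23657) 23658 o))))) 23672 (t (t (t
(t (t (s 23673) 23687 o) 23688 (t (s 23689) 23704 o)) 23897 (t (t (s 24107) 26187 o) 26203 (t (s 26204) 26219 o))) 26427 (t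
(t (t (s 26442) 26443 o) 26458 (t (s 26459) 26460 o)) 26473 (t (t (s 26474) 26475 o) 26476 (t (s 26489) 26490 o)))) 26491 (t (t
(t (t (s 26504) 26505 o) 26506 (t (s 26520) 26521 o)) 26522 (t (t (s 26535) 26536 o) 26537 (t (s 26551) 26552 o))) 26567 (t
(t (t (s 26568) 26569 o) 26682 (t (s 26683) 26698 o)) 26699 (t (t (s 26713) 26714 o) 26715 (s 26716)))))))) 26728 (t (t (t (t (t (t
(t (t (s 26729) 26730 o) 26731 (t (s 26732) 26744 o)) 26745 (t (t (s 26746) 26747 o) 26759 (t (s 26760) 26761 o))) 26762 (t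
(t (t (s 26763) 26775 o) 26776 (t (s 26777) 26778 o)) 26790 (t (t (s 26791) 26792 o) 26793 (t (s 26806) 26807 o)))) 26808 (t (t
(t (t (s 26809) 26823 o) 26824 (t (s 26922) 26938 o)) 26939 (t (t (s 26953) 26954 o) 26955 (t (s 26956) 26969 o))) 26970 (t
(t (t (s 26971) 26972 o) 26984 (t (s 26985) 26986 o)) 26987 (t (t (s 26988) 26999 o) 27000 (t (s 27001) 27002 o))))) 27003 (t (t (t
(t (t (s 27015) 27016 o) 27017 (t (s 27018) 27019 o)) 27030 (t (t (s 27031) 27032 o) 27033 (t (s 27034) 27046 o))) 27047 (t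
(t (t (s 27048) 27049 o) 27063 (t (s 27064) 27065 o)) 27080 (t (t (s 27194) 27195 o) 27209 (t (s 27210) 27211 o)))) 27212 (t (t
(t (t (s 27225) 27226 o) 27227 (t (s 27228) 27240 o)) 27241 (t (t (s 27242) 27243 o) 27255 (t (s 27256) 27257 o))) 27258 (t
(t (t (s 27259) 27271 o) 27272 (t (s 27273) 27274 o)) 27286 (t (t (s 27287) 27288 o) 27289 (t (s 27303) 27304 o)))))) 27305 (t (t (t (t
(t (t (s 27320) 27435 o) 27450 (t (s 27451) 27466 o)) 27467 (t (t (s 27481) 27482 o) 27483 (t (s 27496) 27497 o))) 27498 (t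
(t (t (s 27511) 27512 o) 27513 (t (s 27514) 27527 o)) 27528 (t (t (s 27529) 27542 o) 27543 (t (s 27544) 27545 o)))) 27559 (t (t
(t (t (s 27560) 27576 o) 27722 (t (s 27799) 30059 o)) 30282 (t (t (s 30283) 30298 o) 30299 (t (s 30313) 30314 o))) 30315 (t
(t (t (s 30329) 30330 o) 30331 (t (s 30344) 30345 o)) 30346 (t (t (s 30360) 30361 o) 30376 (t (s 30522) 30538 o))))) 30539 (t (t (t
(t (t (s 30553) 30554 o) 30555 (t (s 30556) 30568 o)) 30569 (t (t (s 30570) 30571 o) 30572 (t (s 30584) 30585 o))) 30586 (t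
(t (t (s 30587) 30599 o) 30600 (t (s 30601) 30602 o)) 30615 (t (t (s 30616) 30617 o) 30618 (t (s 30630) 30631 o)))) 30632 (t (t
(t (t (s 30633) 30646 o) 30647 (t (s 30648) 30662 o)) 30663 (t (t (s 30664) 30679 o) 30778 (t (s 30793) 30794 o))) 30795 (t
(t (t (s 30808) 30809 o) 30810 (t (s 30811) 30812 o)) 30824 (t (t (s 30825) 30826 o) 30827 (t (s 30828) 30839 o))))))) 30840 (t (t (t (t (t
(t (t (s 30841) 30842 o) 30843 (t (s 30855) 30856 o)) 30857 (t (t (s 30858) 30870 o) 30871 (t (s 30872) 30873 o))) 30874 (t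
(t (t (s 30886) 30887 o) 30888 (t (s 30889) 30901 o)) 30902 (t (t (s 30903) 30904 o) 30918 (t (s 30919) 30920 o)))) 30935 (t (t
(t (t (s 31018) 31034 o) 31049 (t (s 31050) 31051 o)) 31064 (t (t (s 31065) 31066 o) 31067 (t (s 31068) 31080 o))) 31081 (t
(t (t (s 31082) 31083 o) 31095 (t (s 31096) 31097 o)) 31098 (t (t (s 31099) 31110 o) 31111 (t (s 31112) 31113 o))))) 31114 (t (t (t
(t (t (s 31126) 31127 o) 31128 (t (s 31129) 31141 o)) 31142 (t (t (s 31143) 31144 o) 31145 (t (s 31158) 31159 o))) 31160 (t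
(t (t (s 31175) 31176 o) 31274 (t (s 31290) 31291 o)) 31305 (t (t (s 31306) 31307 o) 31320 (t (s 31321) 31322 o)))) 31323 (t (t
(t (t (s 31336) 31337 o) 31338 (t (s 31351) 31352 o)) 31353 (t (t (s 31354) 31366 o) 31367 (t (s 31368) 31369 o))) 31382 (t
(t (t (s 31383) 31384 o) 31385 (t (s 31397) 31398 o)) 31399 (t (t (s 31400) 31414 o) 31415 (t (s 31416) 31431 o)))))) 31547 (t (t (t (t
(t (t (s 31593) 31608 o) 31609 (t (s 31623) 31624 o)) 31638 (t (t (s 31639) 31640 o) 31654 (t (s 31655) 31671 o))) 31910 (t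
(t (t (s 34138) 34154 o) 34378 (t (s 34393) 34394 o)) 34395 (t (t (s 34409) 34410 o) 34411 (t (s 34424) 34425 o)))) 34426 (t (t
(t (t (s 34427) 34439 o) 34440 (t (s 34441) 34442 o)) 34455 (t (t (s 34456) 34457 o) 34470 (t (s 34471) 34472 o))) 34486 (t
(t (t (s 34487) 34488 o) 34501 (t (s 34502) 34503 o)) 34518 (t (t (s 34633) 34634 o) 34648 (t (s 34649) 34650 o))))) 34651 (t (t (t
(t (t (s 34664) 34665 o) 34666 (t (s 34667) 34679 o)) 34680 (t (t (s 34681) 34682 o) 34683 (t (s 34695) 34696 o))) 34697 (t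
(t (t (s 34698) 34710 o) 34711 (t (s 34712) 34713 o)) 34726 (t (t (s 34727) 34728 o) 34729 (t (s 34741) 34742 o)))) 34743 (t (t
(t (t (s 34744) 34757 o) 34758 (t (s 34759) 34774 o)) 34775 (t (t (s 34873) 34889 o) 34890 (t (s 34904) 34905 o))) 34906 (t
(t (t (s 34907) 34919 o) 34920 (t (s 34921) 34922 o)) 34923 (t (t (s 34935) 34936 o) 34937 (s 34938))))))))) 34939 (t (t (t (t (t (t (t
(t (t (s 34950) 34951 o) 34952 (t (s 34953) 34954 o)) 34965 (t (t (s 34966) 34967 o) 34968 (t (s 34969) 34981 o))) 34982 (t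
(t (t (s 34983) 34984 o) 34985 (t (s 34997) 34998 o)) 34999 (t (t (s 35000) 35014 o) 35015 (t (s 35031) 35129 o)))) 35130 (t (t
(t (t (s 35145) 35146 o) 35147 (t (s 35160) 35161 o)) 35162 (t (t (s 35163) 35175 o) 35176 (t (s 35177) 35178 o))) 35191 (t
(t (t (s 35192) 35193 o) 35194 (t (s 35206) 35207 o)) 35208 (t (t (s 35209) 35221 o) 35222 (t (s 35223) 35224 o))))) 35225 (t (t (t
(t (t (s 35237) 35238 o) 35239 (t (s 35240) 35253 o)) 35254 (t (t (s 35255) 35256 o) 35270 (t (s 35271) 35386 o))) 35401 (t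
(t (t (s 35402) 35403 o) 35416 (t (s 35417) 35418 o)) 35432 (t (t (s 35433) 35447 o) 35448 (t (s 35449) 35462 o)))) 35463 (t (t
(t (t (s 35464) 35465 o) 35477 (t (s 35478) 35479 o)) 35480 (t (t (s 35493) 35494 o) 35495 (t (s 35509) 35510 o))) 35511 (t
(t (t (s 35526) 35750 o) 35766 (t (s 38233) 38249 o)) 38250 (t (t (s 38264) 38265 o) 38266 (t (s 38280) 38281 o)))))) 38295 (t (t (t (t
(t (t (s 38296) 38311 o) 38357 (t (s 38473) 38488 o)) 38489 (t (t (s 38490) 38504 o) 38505 (t (s 38506) 38507 o))) 38519 (t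
(t (t (s 38520) 38521 o) 38522 (t (s 38535) 38536 o)) 38537 (t (t (s 38538) 38550 o) 38551 (t (s 38552) 38553 o)))) 38566 (t (t
(t (t (s 38567) 38568 o) 38581 (t (s 38582) 38583 o)) 38584 (t (t (s 38597) 38598 o) 38599 (t (s 38613) 38614 o))) 38630 (t
(t (t (s 38728) 38729 o) 38744 (t (s 38745) 38746 o)) 38759 (t (t (s 38760) 38761 o) 38762 (t (s 38763) 38775 o))))) 38776 (t (t (t
(t (t (s 38777) 38778 o) 38790 (t (s 38791) 38792 o)) 38793 (t (t (s 38794) 38805 o) 38806 (t (s 38807) 38808 o))) 38809 (t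
(t (t (s 38821) 38822 o) 38823 (t (s 38824) 38836 o)) 38837 (t (t (s 38838) 38839 o) 38840 (t (s 38853) 38854 o)))) 38855 (t (t
(t (t (s 38870) 38886 o) 38969 (t (s 38984) 38985 o)) 38986 (t (t (s 39000) 39001 o) 39002 (t (s 39003) 39015 o))) 39016 (t
(t (t (s 39017) 39018 o) 39030 (t (s 39031) 39032 o)) 39033 (t (t (s 39034) 39046 o) 39047 (t (s 39048) 39049 o))))))) 39061 (t (t (t (t (t
(t (t (s 39062) 39063 o) 39064 (t (s 39065) 39076 o)) 39077 (t (t (s 39078) 39079 o) 39080 (t (s 39092) 39093 o))) 39094 (t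
(t (t (s 39095) 39096 o) 39109 (t (s 39110) 39111 o)) 39126 (t (t (s 39225) 39240 o) 39241 (t (s 39242) 39256 o)))) 39257 (t (t
(t (t (s 39258) 39271 o) 39272 (t (s 39273) 39274 o)) 39286 (t (t (s 39287) 39288 o) 39289 (t (s 39302) 39303 o))) 39304 (t
(t (t (s 39305) 39317 o) 39318 (t (s 39319) 39320 o)) 39333 (t (t (s 39334) 39335 o) 39336 (t (s 39348) 39349 o))))) 39350 (t (t (t
(t (t (s 39351) 39365 o) 39366 (t (s 39382) 39528 o)) 39543 (t (t (s 39544) 39558 o) 39559 (t (s 39560) 39573 o))) 39574 (t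
(t (t (s 39575) 39589 o) 39590 (t (s 39591) 39605 o)) 39606 (t (t (s 39621) 39622 o) 39845 (t (s 42105) 42182 o)))) 42328 (t (t
(t (t (s 42344) 42345 o) 42359 (t (s 42360) 42361 o)) 42362 (t (t (s 42375) 42376 o) 42377 (t (s 42390) 42391 o))) 42392 (t
(t (t (s 42393) 42406 o) 42407 (t (s 42408) 42421 o)) 42422 (t (t (s 42423) 42437 o) 42438 (t (s 42453) 42454 o)))))) 42584 (t (t (t (t
(t (t (s 42599) 42600 o) 42601 (t (s 42615) 42616 o)) 42617 (t (t (s 42618) 42630 o) 42631 (t (s 42632) 42633 o))) 42645 (t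
(t (t (s 42646) 42647 o) 42648 (t (s 42649) 42661 o)) 42662 (t (t (s 42663) 42664 o) 42676 (t (s 42677) 42678 o)))) 42679 (t (t
(t (t (s 42692) 42693 o) 42694 (t (s 42695) 42709 o)) 42710 (t (t (s 42824) 42839 o) 42840 (t (s 42841) 42855 o))) 42856 (t
(t (t (s 42857) 42858 o) 42870 (t (s 42871) 42872 o)) 42873 (t (t (s 42874) 42885 o) 42886 (t (s 42887) 42888 o))))) 42889 (t (t (t
(t (t (s 42901) 42902 o) 42903 (t (s 42904) 42905 o)) 42916 (t (t (s 42917) 42918 o) 42919 (t (s 42920) 42932 o))) 42933 (t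
(t (t (s 42934) 42935 o) 42948 (t (s 42949) 42950 o)) 42951 (t (t (s 42965) 42966 o) 42982 (t (s 43080) 43081 o)))) 43095 (t (t
(t (t (s 43096) 43097 o) 43098 (t (s 43111) 43112 o)) 43113 (t (t (s 43114) 43126 o) 43127 (t (s 43128) 43129 o))) 43142 (t
(t (t (s 43143) 43144 o) 43145 (t (s 43157) 43158 o)) 43159 (t (t (s 43160) 43172 o) 43173 (s 43174)))))))) 43175 (t (t (t (t (t (t
(t (t (s 43188) 43189 o) 43190 (t (s 43191) 43205 o)) 43206 (t (t (s 43221) 43222 o) 43320 (t (s 43335) 43336 o))) 43337 (t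
(t (t (s 43352) 43353 o) 43367 (t (s 43368) 43369 o)) 43382 (t (t (s 43383) 43384 o) 43398 (t (s 43399) 43400 o)))) 43413 (t (t
(t (t (s 43414) 43415 o) 43428 (t (s 43429) 43430 o)) 43431 (t (t (s 43444) 43445 o) 43446 (t (s 43461) 43462 o))) 43477 (t
(t (t (s 43685) 43700 o) 43701 (t (s 43717) 45797 o)) 46007 (t (t (s 46200) 46215 o) 46216 (t (s 46217) 46231 o))))) 46232 (t (t (t
(t (t (s 46246) 46247 o) 46262 (t (s 46439) 46455 o)) 46456 (t (t (s 46470) 46471 o) 46472 (t (s 46473) 46485 o))) 46486 (t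
(t (t (s 46487) 46488 o) 46501 (t (s 46502) 46503 o)) 46504 (t (t (s 46516) 46517 o) 46518 (t (s 46519) 46532 o)))) 46533 (t (t
(t (t (s 46534) 46549 o) 46550 (t (s 46565) 46679 o)) 46695 (t (t (s 46696) 46710 o) 46711 (t (s 46712) 46713 o))) 46725 (t
(t (t (s 46726) 46727 o) 46728 (t (s 46729) 46741 o)) 46742 (t (t (s 46743) 46744 o) 46756 (t (s 46757) 46758 o)))))) 46759 (t (t (t (t
(t (t (s 46760) 46772 o) 46773 (t (s 46774) 46775 o)) 46788 (t (t (s 46789) 46790 o) 46805 (t (s 46806) 46821 o))) 46935 (t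
(t (t (s 46936) 46950 o) 46951 (t (s 46952) 46953 o)) 46966 (t (t (s 46967) 46968 o) 46969 (t (s 46981) 46982 o)))) 46983 (t (t
(t (t (s 46984) 46985 o) 46996 (t (s 46997) 46998 o)) 46999 (t (t (s 47000) 47012 o) 47013 (t (s 47014) 47015 o))) 47016 (t
(t (t (s 47027) 47028 o) 47029 (t (s 47030) 47031 o)) 47044 (t (t (s 47045) 47046 o) 47061 (t (s 47062) 47077 o))))) 47175 (t (t (t
(t (t (s 47191) 47192 o) 47206 (t (s 47207) 47208 o)) 47209 (t (t (s 47222) 47223 o) 47224 (t (s 47225) 47237 o))) 47238 (t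
(t (t (s 47239) 47240 o) 47253 (t (s 47254) 47255 o)) 47268 (t (t (s 47269) 47270 o) 47271 (t (s 47283) 47284 o)))) 47285 (t (t
(t (t (s 47286) 47300 o) 47301 (t (s 47302) 47317 o)) 47479 (t (t (s 47494) 47495 o) 47509 (t (s 47510) 47524 o))) 47525 (t
(t (t (s 47526) 47539 o) 47540 (t (s 47541) 47556 o)) 47557 (t (t (s 49622) 49832 o) 50310 (s 50326))))))) 50327 (t (t (t (t (t
(t (t (s 50328) 50341 o) 50342 (t (s 50343) 50357 o)) 50358 (t (t (s 50359) 50373 o) 50374 (t (s 50389) 50550 o))) 50565 (t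
(t (t (s 50566) 50567 o) 50568 (t (s 50581) 50582 o)) 50583 (t (t (s 50584) 50596 o) 50597 (t (s 50598) 50599 o)))) 50612 (t (t
(t (t (s 50613) 50614 o) 50615 (t (s 50628) 50629 o)) 50630 (t (t (s 50645) 50661 o) 50790 (t (s 50805) 50806 o))) 50807 (t
(t (t (s 50821) 50822 o) 50823 (t (s 50824) 50825 o)) 50836 (t (t (s 50837) 50838 o) 50839 (t (s 50840) 50852 o))))) 50853 (t (t (t
(t (t (s 50854) 50855 o) 50868 (t (s 50869) 50870 o)) 50871 (t (t (s 50884) 50885 o) 50886 (t (s 50901) 50902 o))) 50917 (t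
(t (t (s 51030) 51045 o) 51046 (t (s 51047) 51062 o)) 51063 (t (t (s 51064) 51077 o) 51078 (t (s 51079) 51080 o)))) 51092 (t (t
(t (t (s 51093) 51094 o) 51095 (t (s 51108) 51109 o)) 51110 (t (t (s 51111) 51123 o) 51124 (t (s 51125) 51126 o))) 51140 (t
(t (t (s 51141) 51142 o) 51157 (t (s 51173) 51287 o)) 51302 (t (t (s 51303) 51304 o) 51317 (t (s 51318) 51319 o)))))) 51320 (t (t (t (t
(t (t (s 51332) 51333 o) 51334 (t (s 51335) 51348 o)) 51349 (t (t (s 51350) 51351 o) 51364 (t (s 51365) 51366 o))) 51379 (t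
(t (t (s 51380) 51381 o) 51382 (t (s 51396) 51397 o)) 51413 (t (t (s 51636) 51652 o) 54454 (t (s 54470) 54677 o)))) 54693 (t (t
(t (t (s 54694) 54695 o) 54709 (t (s 54710) 54711 o)) 54725 (t (t (s 54726) 54741 o) 54742 (t (s 54916) 54917 o))) 54918 (t
(t (t (s 54932) 54933 o) 54934 (t (s 54935) 54948 o)) 54949 (t (t (s 54950) 54951 o) 54964 (t (s 54965) 54966 o))))) 54981 (t (t (t
(t (t (s 54982) 54997 o) 55013 (t (s 55157) 55158 o)) 55172 (t (t (s 55173) 55174 o) 55175 (t (s 55188) 55189 o))) 55190 (t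
(t (t (s 55191) 55203 o) 55204 (t (s 55205) 55206 o)) 55220 (t (t (s 55221) 55222 o) 55236 (t (s 55237) 55253 o)))) 55414 (t (t
(t (t (s 55415) 55429 o) 55430 (t (s 55444) 55445 o)) 55446 (t (t (s 55459) 55460 o) 55461 (t (s 55475) 55476 o))) 55477 (t
(t (t (s 55492) 59062 o) 59284 (t (s 59285) 59286 o)) 59300 (t (t (s 59301) 59302 o) 59317 (s 59572))))))))))

noncomputable def treeR : KT :=
  (t (t (t (t (t (t (t (t (t
(t (t (s 30344) 30345 o) 30361 (t (s 30584) 30600 o)) 30601 (t (t (s 34695) 34696 o) 34712 (t (s 34713) 34729 o))) 34935 (t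
(t (t (s 34951) 34952 o) 34953 (t (s 34969) 35175 o)) 35191 (t (t (s 35192) 35209 o) 39303 (s 39304)))) 39320 (t (t
(t (t (s 39543) 39559 o) 39560 (t (s 95881) 99975 o)) 99976 (t (t (s 99977) 99992 o) 99993 (t (s 100215) 100216 o))) 100231 (t
(t (t (s 100232) 100233 o) 100249 (t (s 100455) 100471 o)) 100472 (t (t (s 100489) 100711 o) 104327 (s 104328))))) 104344 (t (t (t
(t (t (s 104345) 104360 o) 104567 (t (s 104583) 104584 o)) 104600 (t (t (s 104601) 104807 o) 104822 (t (s 104823) 104824 o))) 104839 (t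
(t (t (s 104840) 105079 o) 105080 (t (s 108935) 226937 o)) 226953 (t (t (s 226954) 227176 o) 227192 (s 227193)))) 231048 (t (t
(t (t (s 231049) 231065 o) 231287 (t (s 231288) 231304 o)) 231305 (t (t (s 231321) 231527 o) 231528 (s 231544))) 231545 (t
(t (t (s 231561) 231783 o) 231784 (t (s 231801) 235400 o)) 235416 (t (t (s 235417) 235639 o) 235656 (s 235657)))))) 235673 (t (t (t (t
(t (t (s 235879) 235895 o) 235896 (t (s 235912) 235913 o)) 236151 (t (t (s 236152) 236168 o) 240008 (t (s 292488) 292489 o))) 292728 (t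
(t (t (s 296583) 296600 o) 296823 (t (s 296839) 296840 o)) 296856 (t (t (s 296857) 296873 o) 297063 (s 297079)))) 297080 (t (t
(t (t (s 297096) 297319 o) 297336 (t (s 300968) 301191 o)) 301208 (t (t (s 301224) 301430 o) 301431 (s 301447))) 301448 (t
(t (t (s 301464) 301687 o) 301703 (t (s 301704) 546697 o)) 550793 (t (t (s 550809) 550810 o) 550825 (s 551016))))) 551048 (t (t (t
(t (t (s 551049) 551065 o) 551287 (t (s 551288) 551305 o)) 554904 (t (t (s 554905) 554921 o) 555127 (t (s 555144) 555145 o))) 555161 (t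
(t (t (s 555162) 555177 o) 555383 (t (s 555384) 555401 o)) 555416 (t (t (s 555417) 555433 o) 555639 (s 555640)))) 555656 (t (t
(t (t (s 555673) 555896 o) 559273 (t (s 559495) 559512 o)) 559735 (t (t (s 559751) 559752 o) 559753 (s 616328))) 616329 (t
(t (t (s 616345) 616568 o) 616585 (t (s 620168) 620169 o)) 620184 (t (t (s 620185) 620408 o) 620424 (s 620425))))))) 620441 (t (t (t (t (t
(t (t (s 620442) 620457 o) 620663 (t (s 620664) 620680 o)) 620681 (t (t (s 620696) 620697 o) 620698 (t (s 620713) 620919 o))) 620920 (t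
(t (t (s 620936) 620953 o) 621175 (t (s 621176) 624536 o)) 624553 (t (t (s 624759) 624775 o) 624776 (s 624777)))) 624792 (t (t
(t (t (s 624793) 624809 o) 624999 (t (s 625015) 625016 o)) 625031 (t (t (s 625032) 625033 o) 625048 (s 625049))) 625271 (t
(t (t (s 625272) 625287 o) 625288 (t (s 625289) 625304 o)) 629127 (t (t (s 629144) 629367 o) 629383 (s 629384))))) 747385 (t (t (t
(t (t (s 747401) 747402 o) 747418 (t (s 747624) 747640 o)) 747641 (t (t (s 747657) 747880 o) 747897 (t (s 751240) 751241 o))) 751257 (t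
(t (t (s 751480) 751496 o) 751497 (t (s 751513) 751514 o)) 751720 (t (t (s 751735) 751736 o) 751737 (s 751752)))) 751753 (t (t
(t (t (s 751754) 751769 o) 751770 (t (s 751976) 751991 o)) 751992 (t (t (s 751993) 752008 o) 752009 (s 752025))) 752232 (t
(t (t (s 752248) 752265 o) 755609 (t (s 755625) 755831 o)) 755848 (t (t (s 755849) 755865 o) 755881 (s 756071)))))) 756087 (t (t (t (t
(t (t (s 756088) 756104 o) 756105 (t (s 756121) 756328 o)) 756343 (t (t (s 756344) 756345 o) 756360 (t (s 756361) 760216 o))) 760439 (t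
(t (t (s 760456) 812936 o) 812937 (t (s 812953) 813176 o)) 813192 (t (t (s 813432) 816792 o) 817031 (s 817032)))) 817048 (t (t
(t (t (s 817049) 817065 o) 817271 (t (s 817272) 817287 o)) 817288 (t (t (s 817289) 817304 o) 817305 (s 817321))) 817527 (t
(t (t (s 817528) 817543 o) 817544 (t (s 817560) 817561 o)) 817577 (t (t (s 817783) 817800 o) 821383 (s 821400))))) 821417 (t (t (t
(t (t (s 821639) 821640 o) 821656 (t (s 821657) 821879 o)) 821880 (t (t (s 821895) 821896 o) 821912 (t (s 825768) 825991 o))) 1599368 (t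
(t (t (s 1599384) 1599385 o) 1599401 (t (s 1599623) 1599624 o)) 1599863 (t (t (s 1603240) 1603463 o) 1603479 (s 1603480)))) 1603496 (t (t
(t (t (s 1603497) 1603719 o) 1603736 (t (s 1603753) 1603959 o)) 1603975 (t (t (s 1603976) 1603992 o) 1603993 (s 1604009))) 1604215 (t
(t (t (s 1604231) 1604232 o) 1604248 (t (s 1607592) 1607608 o)) 1607831 (t (t (s 1607848) 1608070 o) 1608071 (s 1608087)))))))) 1608104 (t (t (t (t (t (t
(t (t (s 1608327) 1608344 o) 1612200 (t (s 1612438) 1612439 o)) 1612455 (t (t (s 1664904) 1668760 o) 1668776 (t (s 1668999) 1669000 o))) 1669016 (t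
(t (t (s 1669017) 1669032 o) 1669033 (t (s 1669239) 1669255 o)) 1669256 (t (t (s 1669272) 1669273 o) 1669289 (s 1669495)))) 1669511 (t (t
(t (t (s 1669512) 1669751 o) 1672855 (t (s 1672872) 1672888 o)) 1673095 (t (t (s 1673111) 1673128 o) 1673350 (s 1673351))) 1673367 (t
(t (t (s 1673368) 1673384 o) 1673385 (t (s 1673607) 1673624 o)) 1673640 (t (t (s 1673847) 1673863 o) 1673880 (s 1677224))))) 1677240 (t (t (t
(t (t (s 1677463) 1677479 o) 1677480 (t (s 1677496) 1677686 o)) 1677702 (t (t (s 1677718) 1677719 o) 1677735 (t (s 1677736) 1677958 o))) 1677959 (t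
(t (t (s 1677975) 1795976 o) 1795977 (t (s 1795993) 1796216 o)) 1799832 (t (t (s 1800071) 1800072 o) 1800088 (s 1800089)))) 1800105 (t (t
(t (t (s 1800311) 1800328 o) 1800345 (t (s 1800361) 1800567 o)) 1800568 (t (t (s 1800584) 1800585 o) 1800601 (s 1800823))) 1800824 (t
(t (t (s 1800840) 1803944 o) 1804167 (t (s 1804183) 1804184 o)) 1804200 (t (t (s 1804201) 1804423 o) 1804440 (s 1804457)))))) 1804663 (t (t (t (t
(t (t (s 1804679) 1804680 o) 1804696 (t (s 1804697) 1804919 o)) 1804935 (t (t (s 1804936) 1804952 o) 1808296 (t (s 1808312) 1808535 o))) 1808552 (t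
(t (t (s 1808758) 1808774 o) 1808775 (t (s 1808791) 1808792 o)) 1808808 (t (t (s 1809031) 1809047 o) 1861512 (s 1861528)))) 1861545 (t (t
(t (t (s 1865384) 1865607 o) 1865623 (t (s 1865624) 1865640 o)) 1865641 (t (t (s 1865863) 1865880 o) 1865896 (s 1865897))) 1866103 (t
(t (t (s 1866119) 1866120 o) 1866136 (t (s 1866359) 1866375 o)) 1869496 (t (t (s 1869718) 1869719 o) 1869735 (s 1869736))))) 1869752 (t (t (t
(t (t (s 1869958) 1869975 o) 1869992 (t (s 1870214) 1870231 o)) 1870248 (t (t (s 1870471) 1870487 o) 1870488 (t (s 1874087) 1874104 o))) 1874310 (t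
(t (t (s 1874326) 1874327 o) 1874343 (t (s 1874344) 1874566 o)) 1874582 (t (t (s 1874583) 2123641 o) 2123657 (s 2123880)))) 2127513 (t (t
(t (t (s 2127736) 2127752 o) 2127753 (t (s 2127769) 2127770 o)) 2127992 (t (t (s 2128009) 2128026 o) 2128232 (s 2128248))) 2128249 (t
(t (t (s 2128265) 2128488 o) 2132121 (t (s 2132343) 2132344 o)) 2132360 (t (t (s 2132361) 2132377 o) 2132600 (s 2132617))))))) 2193032 (t (t (t (t (t
(t (t (s 2193033) 2193049 o) 2193256 (t (s 2193272) 2193273 o)) 2193289 (t (t (s 2193306) 2193512 o) 2193528 (t (s 2193529) 2193545 o))) 2193768 (t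
(t (t (s 2197145) 2197368 o) 2197384 (t (s 2197385) 2197401 o)) 2197607 (t (t (s 2197623) 2197624 o) 2197640 (s 2197641)))) 2197657 (t (t
(t (t (s 2197863) 2197880 o) 2197897 (t (s 2198136) 2198153 o)) 2201753 (t (t (s 2201975) 2201976 o) 2201992 (s 2202008))) 2202231 (t
(t (t (s 2202232) 2202248 o) 2320233 (t (s 2320249) 2324105 o)) 2324328 (t (t (s 2324344) 2324345 o) 2324361 (s 2324362))))) 2324378 (t (t (t
(t (t (s 2324584) 2324601 o) 2324618 (t (s 2324824) 2324840 o)) 2324841 (t (t (s 2324857) 2325080 o) 2328440 (t (s 2328456) 2328457 o))) 2328473 (t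
(t (t (s 2328679) 2328696 o) 2328713 (t (s 2328935) 2328936 o)) 2328952 (t (t (s 2328953) 2328969 o) 2329192 (s 2329209)))) 2332825 (t (t
(t (t (s 2333048) 2333064 o) 2333065 (t (s 2333304) 2389640 o)) 2389657 (t (t (s 2389880) 2389896 o) 2389897 (s 2389913))) 2389914 (t
(t (t (s 2390136) 2390153 o) 2390376 (t (s 2390392) 2393992 o)) 2394008 (t (t (s 2394009) 2394025 o) 2394231 (s 2394248)))))) 2394265 (t (t (t (t
(t (t (s 2394471) 2394487 o) 2394488 (t (s 2394504) 2394521 o)) 2394744 (t (t (s 2394761) 2398600 o) 2398616 (t (s 2398839) 2398856 o))) 4224649 (t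
(t (t (s 4228743) 4228744 o) 4228745 (t (s 4228760) 4228761 o)) 4228983 (t (t (s 4228984) 4228999 o) 4229000 (s 4229001)))) 4229017 (t (t
(t (t (s 4229223) 4229239 o) 4229240 (t (s 4229257) 4229479 o)) 4233095 (t (t (s 4233096) 4233112 o) 4233113 (s 4233128))) 4233335 (t
(t (t (s 4233351) 4233352 o) 4233368 (t (s 4233369) 4233575 o)) 4233590 (t (t (s 4233591) 4233592 o) 4233607 (s 4233608))))) 4233847 (t (t (t
(t (t (s 4233848) 4237703 o) 4294264 (t (s 4294279) 4294280 o)) 4294281 (t (t (s 4294297) 4294519 o) 4294520 (t (s 4294537) 4294759 o))) 4298136 (t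
(t (t (s 4298359) 4298375 o) 4298376 (t (s 4298392) 4298393 o)) 4298408 (t (t (s 4298599) 4298615 o) 4298616 (s 4298631)))) 4298632 (t (t
(t (t (s 4298648) 4298649 o) 4298855 (t (s 4298870) 4298871 o)) 4298872 (t (t (s 4298887) 4298888 o) 4298905 (s 4299111))) 4299127 (t
(t (t (s 4299128) 4302727 o) 4302744 (t (s 4302760) 4302967 o)) 4302983 (t (t (s 4302984) 4303000 o) 4303207 (s 4303222))))))))) 4303223 (t (t (t (t (t (t (t
(t (t (s 4303239) 4303240 o) 4307335 (t (s 4421241) 4425336 o)) 4425337 (t (t (s 4425352) 4425353 o) 4425369 (t (s 4425576) 4425592 o))) 4425593 (t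
(t (t (s 4425609) 4425831 o) 4425832 (t (s 4425849) 4429192 o)) 4429431 (t (t (s 4429448) 4429449 o) 4429464 (s 4429465)))) 4429671 (t (t
(t (t (s 4429687) 4429688 o) 4429704 (t (s 4429705) 4429721 o)) 4429927 (t (t (s 4429943) 4429944 o) 4429960 (s 4429961))) 4429977 (t
(t (t (s 4430183) 4430184 o) 4430199 (t (s 4430200) 4430217 o)) 4430440 (t (t (s 4433800) 4433816 o) 4433817 (s 4434039))))) 4434055 (t (t (t
(t (t (s 4434056) 4434072 o) 4434279 (t (s 4434295) 4434296 o)) 4434311 (t (t (s 4434312) 4490872 o) 4490887 (t (s 4490888) 4490904 o))) 4490905 (t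
(t (t (s 4491127) 4491128 o) 4491144 (t (s 4491367) 4491384 o)) 4494983 (t (t (s 4495000) 4495016 o) 4495223 (s 4495239)))) 4495240 (t (t
(t (t (s 4495256) 4495257 o) 4495272 (t (s 4495478) 4495479 o)) 4495495 (t (t (s 4495496) 4495512 o) 4495513 (s 4495719))) 4495734 (t
(t (t (s 4495735) 4495752 o) 4499368 (t (s 4499591) 4499607 o)) 4499608 (t (t (s 4499830) 4499847 o) 4499848 (s 4499863)))))) 4745096 (t (t (t (t
(t (t (s 4745097) 4745113 o) 4745336 (t (s 4745353) 4748936 o)) 4748937 (t (t (s 4748952) 4748953 o) 4749176 (t (s 4749192) 4749193 o))) 4749209 (t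
(t (t (s 4749210) 4749225 o) 4749431 (t (s 4749432) 4749448 o)) 4749449 (t (t (s 4749464) 4749465 o) 4749466 (s 4749481)))) 4749687 (t (t
(t (t (s 4749688) 4749704 o) 4749721 (t (s 4749943) 4749944 o)) 4753304 (t (t (s 4753321) 4753527 o) 4753543 (s 4753544))) 4753545 (t
(t (t (s 4753560) 4753561 o) 4753577 (t (s 4753767) 4753783 o)) 4753784 (t (t (s 4753799) 4753800 o) 4753801 (s 4753816))))) 4753817 (t (t (t
(t (t (s 4754039) 4754040 o) 4754055 (t (s 4754056) 4754057 o)) 4754072 (t (t (s 4757895) 4757912 o) 4758135 (t (s 4758151) 4758152 o))) 4810633 (t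
(t (t (s 4814472) 4814473 o) 4814489 (t (s 4814712) 4814728 o)) 4814729 (t (t (s 4814744) 4814745 o) 4814746 (s 4814761)))) 4814967 (t (t
(t (t (s 4814968) 4814984 o) 4815001 (t (s 4815223) 4815224 o)) 4818568 (t (t (s 4818569) 4818584 o) 4818585 (s 4818807))) 4818808 (t
(t (t (s 4818823) 4818824 o) 4818825 (t (s 4818840) 4818841 o)) 4818857 (t (t (s 4819047) 4819063 o) 4819064 (s 4819079))))))) 4819080 (t (t (t (t (t
(t (t (s 4819081) 4819096 o) 4819097 (t (s 4819113) 4819303 o)) 4819319 (t (t (s 4819320) 4819335 o) 4819336 (t (s 4819337) 4819352 o))) 4819353 (t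
(t (t (s 4819575) 4819591 o) 4819592 (t (s 4822936) 4823159 o)) 4823175 (t (t (s 4823176) 4823192 o) 4823193 (s 4823399)))) 4823415 (t (t
(t (t (s 4823416) 4823431 o) 4823432 (t (s 4823448) 4823671 o)) 4823672 (t (t (s 4823687) 4823688 o) 4827527 (s 4941689))) 4941705 (t
(t (t (s 4941928) 4941945 o) 4945529 (t (s 4945544) 4945545 o)) 4945546 (t (t (s 4945561) 4945768 o) 4945784 (s 4945785))))) 4945800 (t (t (t
(t (t (s 4945801) 4945802 o) 4945817 (t (s 4945818) 4946024 o)) 4946039 (t (t (s 4946040) 4946041 o) 4946056 (t (s 4946057) 4946073 o))) 4946074 (t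
(t (t (s 4946280) 4946296 o) 4946313 (t (s 4946536) 4949640 o)) 4949641 (t (t (s 4949657) 4949879 o) 4949880 (s 4949896)))) 4949897 (t (t
(t (t (s 4949913) 4949929 o) 4950119 (t (s 4950120) 4950135 o)) 4950136 (t (t (s 4950137) 4950152 o) 4950153 (s 4950169))) 4950185 (t
(t (t (s 4950375) 4950376 o) 4950391 (t (s 4950392) 4950393 o)) 4950408 (t (t (s 4950409) 4950425 o) 4950632 (s 4950647)))))) 4950648 (t (t (t (t
(t (t (s 4950649) 4950664 o) 4950665 (t (s 4954231) 4954248 o)) 4954249 (t (t (s 4954264) 4954265 o) 4954471 (t (s 4954487) 4954488 o))) 4954504 (t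
(t (t (s 4954505) 4954743 o) 4954744 (t (s 4954760) 5007240 o)) 5007480 (t (t (s 5011080) 5011081 o) 5011096 (s 5011097)))) 5011320 (t (t
(t (t (s 5011335) 5011336 o) 5011337 (t (s 5011352) 5011353 o)) 5011369 (t (t (s 5011575) 5011576 o) 5011591 (s 5011592))) 5011608 (t
(t (t (s 5011609) 5011831 o) 5011848 (t (s 5015175) 5015192 o)) 5015431 (t (t (s 5015432) 5015448 o) 5015449 (s 5015465))))) 5015655 (t (t (t
(t (t (s 5015671) 5015672 o) 5015687 (t (s 5015688) 5015704 o)) 5015705 (t (t (s 5015721) 5015911 o) 5015927 (t (s 5015928) 5015943 o))) 5015944 (t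
(t (t (s 5015960) 5015961 o) 5016183 (t (s 5016184) 5016199 o)) 5016200 (t (t (s 5016216) 5019783 o) 5019800 (s 5019816)))) 5020039 (t (t
(t (t (s 5020040) 5020056 o) 5020279 (t (s 5020295) 5020296 o)) 5793672 (t (t (s 5797528) 5797544 o) 5797767 (s 5797768))) 5797784 (t
(t (t (s 5797785) 5797800 o) 5797801 (t (s 5798007) 5798023 o)) 5798024 (t (t (s 5798040) 5798041 o) 5798057 (s 5798263)))))))) 5798279 (t (t (t (t (t (t
(t (t (s 5798280) 5798519 o) 5801623 (t (s 5801640) 5801656 o)) 5801863 (t (t (s 5801879) 5801896 o) 5802118 (t (s 5802119) 5802135 o))) 5802136 (t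
(t (t (s 5802152) 5802153 o) 5802375 (t (s 5802392) 5802408 o)) 5802615 (t (t (s 5802631) 5802648 o) 5805992 (s 5806008)))) 5806231 (t (t
(t (t (s 5806247) 5806248 o) 5806264 (t (s 5806454) 5806470 o)) 5806486 (t (t (s 5806487) 5806503 o) 5806504 (s 5806726))) 5806727 (t
(t (t (s 5806743) 5863048 o) 5863064 (t (s 5863080) 5863303 o)) 5863304 (t (t (s 5863320) 5863337 o) 5863543 (s 5863559))))) 5863560 (t (t (t
(t (t (s 5863799) 5867143 o) 5867159 (t (s 5867160) 5867176 o)) 5867399 (t (t (s 5867415) 5867416 o) 5867432 (t (s 5867433) 5867639 o))) 5867655 (t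
(t (t (s 5867672) 5867688 o) 5867689 (t (s 5867895) 5867911 o)) 5867928 (t (t (s 5868151) 5868167 o) 5871255 (s 5871272)))) 5871288 (t (t
(t (t (s 5871494) 5871511 o) 5871527 (t (s 5871528) 5871544 o)) 5871734 (t (t (s 5871750) 5871751 o) 5871766 (s 5871767))) 5871784 (t
(t (t (s 5871800) 5871990 o) 5872006 (t (s 5872007) 5872023 o)) 5872024 (t (t (s 5872040) 5872247 o) 5872262 (s 5872263)))))) 5872279 (t (t (t (t
(t (t (s 5875863) 5875879 o) 5876102 (t (s 5876118) 5876119 o)) 5876135 (t (t (s 5994120) 5994136 o) 5994137 (t (s 5994360) 5994376 o))) 5994377 (t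
(t (t (s 5994393) 5994409 o) 5994615 (t (s 5994616) 5994632 o)) 5994633 (t (t (s 5994649) 5994871 o) 5994872 (s 5998215)))) 5998231 (t (t
(t (t (s 5998232) 5998248 o) 5998455 (t (s 5998471) 5998472 o)) 5998488 (t (t (s 5998489) 5998505 o) 5998711 (s 5998727))) 5998728 (t
(t (t (s 5998744) 5998745 o) 5998761 (t (s 5998967) 5998983 o)) 5998984 (t (t (s 5999000) 5999001 o) 5999223 (s 5999240))))) 6002344 (t (t (t
(t (t (s 6002360) 6002566 o) 6002567 (t (s 6002583) 6002584 o)) 6002600 (t (t (s 6002806) 6002822 o) 6002823 (t (s 6002839) 6002840 o))) 6002856 (t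
(t (t (s 6003062) 6003079 o) 6003095 (t (s 6003096) 6003319 o)) 6003335 (t (t (s 6003336) 6006696 o) 6006935 (s 6007158)))) 6007174 (t (t
(t (t (s 6007191) 6007207 o) 6059672 (t (s 6059688) 6059911 o)) 6059912 (t (t (s 6059928) 6059944 o) 6059945 (s 6060151))) 6060167 (t
(t (t (s 6060168) 6060184 o) 6060407 (t (s 6063767) 6063783 o)) 6063784 (t (t (s 6063800) 6064023 o) 6064040 (s 6064262))))))) 6064263 (t (t (t (t (t
(t (t (s 6064279) 6064280 o) 6064296 (t (s 6064297) 6064519 o)) 6064535 (t (t (s 6064536) 6064552 o) 6064775 (t (s 6064792) 6067896 o))) 6068102 (t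
(t (t (s 6068118) 6068119 o) 6068135 (t (s 6068136) 6068152 o)) 6068358 (t (t (s 6068374) 6068375 o) 6068391 (s 6068392)))) 6068408 (t (t
(t (t (s 6068614) 6068630 o) 6068631 (t (s 6068648) 6068870 o)) 6068871 (t (t (s 6068887) 6072487 o) 6072726 (s 6072743))) 6321800 (t
(t (t (s 6321801) 6321817 o) 6322024 (t (s 6322040) 6322041 o)) 6322057 (t (t (s 6322074) 6322280 o) 6322296 (s 6322297))))) 6322313 (t (t (t
(t (t (s 6322536) 6325913 o) 6326136 (t (s 6326152) 6326153 o)) 6326169 (t (t (s 6326375) 6326391 o) 6326392 (t (s 6326408) 6326409 o))) 6326425 (t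
(t (t (s 6326631) 6326648 o) 6326665 (t (s 6326904) 6326921 o)) 6330521 (t (t (s 6330743) 6330744 o) 6330760 (s 6330776)))) 6330999 (t (t
(t (t (s 6331000) 6331016 o) 6387337 (t (s 6387560) 6387576 o)) 6387816 (t (t (s 6391416) 6391432 o) 6391433 (s 6391449))) 6391671 (t
(t (t (s 6391672) 6391688 o) 6391689 (t (s 6391705) 6391911 o)) 6391928 (t (t (s 6391945) 6392167 o) 6392184 (s 6395545)))))) 6395768 (t (t (t (t
(t (t (s 6395784) 6395801 o) 6396007 (t (s 6396023) 6396024 o)) 6396040 (t (t (s 6396041) 6396056 o) 6396057 (t (s 6396263) 6396279 o))) 6396280 (t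
(t (t (s 6396296) 6396297 o) 6396535 (t (s 6396536) 6396552 o)) 6400375 (t (t (s 6400392) 6518393 o) 6518409 (s 6518410)))) 6518632 (t (t
(t (t (s 6518633) 6518649 o) 6518666 (t (s 6518872) 6518888 o)) 6518889 (t (t (s 6518905) 6519128 o) 6522488 (s 6522504))) 6522505 (t
(t (t (s 6522521) 6522728 o) 6522744 (t (s 6522745) 6522761 o)) 6522983 (t (t (s 6522984) 6523000 o) 6523001 (s 6523017))))) 6523018 (t (t (t
(t (t (s 6523240) 6523257 o) 6523496 (t (s 6523513) 6526840 o)) 6526856 (t (t (s 6526857) 6526873 o) 6527079 (t (s 6527096) 6527112 o))) 6527113 (t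
(t (t (s 6527129) 6527335 o) 6527336 (t (s 6527352) 6527369 o)) 6527592 (t (t (s 6527608) 6531448 o) 6531464 (s 6583944)))) 6583945 (t (t
(t (t (s 6583961) 6584168 o) 6584184 (t (s 6584201) 6584424 o)) 6584440 (t (t (s 6588040) 6588056 o) 6588057 (s 6588279))) 6588280 (t
(t (t (s 6588296) 6588313 o) 6588519 (t (s 6588535) 6588536 o)) 6588552 (t (t (s 6588553) 6588569 o) 6588775 (s 6588792)))))))))) 6588809 (t (t (t (t (t (t (t (t
(t (t (s 6589048) 6592392 o) 6592408 (t (s 6592409) 6592631 o)) 6592648 (t (t (s 6592664) 6592665 o) 6592871 (t (s 6592887) 6592904 o))) 6592920 (t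
(t (t (s 6593143) 6593144 o) 6593160 (t (s 12613241) 12613257 o)) 12613258 (t (t (s 12613480) 12613496 o) 12613497 (s 12617352)))) 12617353 (t (t
(t (t (s 12617369) 12617591 o) 12617592 (t (s 12617608) 12617609 o)) 12617625 (t (t (s 12617831) 12617832 o) 12617848 (t (s 12617849) 12617865 o))) 12618087 (t
(t (t (s 12618088) 12618105 o) 12621704 (t (s 12621720) 12621721 o)) 12621943 (t (t (s 12621960) 12621961 o) 12621977 (s 12622183))))) 12622199 (t (t (t
(t (t (s 12622200) 12622216 o) 12622217 (t (s 12622455) 12622456 o)) 12622472 (t (t (s 12626312) 12678777 o) 12682872 (t (s 12682873) 12682888 o))) 12682889 (t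
(t (t (s 12682905) 12683112 o) 12683128 (t (s 12683129) 12683145 o)) 12683367 (t (t (s 12683368) 12683385 o) 12686728 (s 12686967)))) 12686984 (t (t
(t (t (s 12686985) 12687000 o) 12687001 (t (s 12687207) 12687223 o)) 12687224 (t (t (s 12687240) 12687241 o) 12687257 (s 12687463))) 12687479 (t
(t (t (s 12687480) 12687496 o) 12687497 (t (s 12687513) 12687719 o)) 12687720 (t (t (s 12687735) 12687736 o) 12687753 (s 12687976)))))) 12691336 (t (t (t (t
(t (t (s 12691352) 12691353 o) 12691575 (t (s 12691591) 12691592 o)) 12691608 (t (t (s 12691815) 12691831 o) 12691832 (t (s 12691847) 12691848 o))) 12809833 (t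
(t (t (s 12809849) 12809850 o) 12810088 (t (s 12810089) 12813944 o)) 12813945 (t (t (s 12813961) 12813962 o) 12814184 (s 12814200)))) 12814201 (t (t
(t (t (s 12814217) 12814218 o) 12814440 (t (s 12814457) 12814680 o)) 12818056 (t (t (s 12818057) 12818073 o) 12818279 (s 12818295))) 12818296 (t
(t (t (s 12818312) 12818313 o) 12818329 (t (s 12818535) 12818536 o)) 12818552 (t (t (s 12818553) 12818569 o) 12818791 (s 12818792))))) 12818808 (t (t (t
(t (t (s 12818809) 12818825 o) 12819048 (t (s 12819064) 12822425 o)) 12822647 (t (t (s 12822664) 12822665 o) 12822887 (t (s 12822903) 12822904 o))) 12822920 (t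
(t (t (s 12875385) 12875624 o) 12879480 (t (s 12879496) 12879497 o)) 12879513 (t (t (s 12879735) 12879736 o) 12879752 (s 12879753)))) 12879769 (t (t
(t (t (s 12879975) 12879992 o) 12883608 (t (s 12883831) 12883847 o)) 12883848 (t (t (s 12883864) 12883865 o) 12884071 (s 12884087))) 12884088 (t
(t (t (s 12884104) 12884121 o) 12884327 (t (s 12884343) 12884344 o)) 12884360 (t (t (s 12884361) 12884599 o) 12884600 (s 12888199))))))) 12888216 (t (t (t (t (t
(t (t (s 12888439) 12888455 o) 12888456 (t (s 13133689) 13133705 o)) 13133706 (t (t (s 13133722) 13133928 o) 13133944 (t (s 13133945) 13133961 o))) 13134184 (t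
(t (t (s 13134201) 13137544 o) 13137545 (t (s 13137561) 13137784 o)) 13137800 (t (t (s 13137801) 13137817 o) 13137818 (s 13138024)))) 13138039 (t (t
(t (t (s 13138040) 13138041 o) 13138056 (t (s 13138057) 13138058 o)) 13138073 (t (t (s 13138074) 13138280 o) 13138295 (s 13138296))) 13138297 (t
(t (t (s 13138312) 13138313 o) 13138329 (t (s 13138536) 13138552 o)) 13138569 (t (t (s 13141913) 13141929 o) 13142135 (s 13142152))))) 13142153 (t (t (t
(t (t (s 13142169) 13142185 o) 13142375 (t (s 13142391) 13142392 o)) 13142408 (t (t (s 13142409) 13142425 o) 13142632 (t (s 13142647) 13142648 o))) 13142649 (t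
(t (t (s 13142664) 13142665 o) 13146520 (t (s 13146743) 13146760 o)) 13199225 (t (t (s 13199241) 13199464 o) 13199481 (s 13203065)))) 13203080 (t (t
(t (t (s 13203081) 13203082 o) 13203097 (t (s 13203304) 13203320 o)) 13203321 (t (t (s 13203336) 13203337 o) 13203338 (s 13203353))) 13203354 (t
(t (t (s 13203560) 13203575 o) 13203576 (t (s 13203577) 13203592 o)) 13203593 (t (t (s 13203609) 13203610 o) 13203816 (s 13203832)))))) 13203849 (t (t (t (t
(t (t (s 13204072) 13207176 o) 13207177 (t (s 13207193) 13207415 o)) 13207416 (t (t (s 13207432) 13207433 o) 13207449 (t (s 13207465) 13207655 o))) 13207656 (t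
(t (t (s 13207671) 13207672 o) 13207673 (t (s 13207688) 13207689 o)) 13207705 (t (t (s 13207721) 13207911 o) 13207912 (s 13207927)))) 13207928 (t (t
(t (t (s 13207929) 13207944 o) 13207945 (t (s 13207961) 13208168 o)) 13208183 (t (t (s 13208184) 13208185 o) 13208200 (s 13208201))) 13211767 (t
(t (t (s 13211784) 13211785 o) 13211800 (t (s 13211801) 13212007 o)) 13212023 (t (t (s 13212024) 13212040 o) 13212041 (s 13212279))))) 13212280 (t (t (t
(t (t (s 13212296) 13330281 o) 13330297 (t (s 13330298) 13330314 o)) 13330536 (t (t (s 13330553) 13334137 o) 13334153 (t (s 13334154) 13334169 o))) 13334376 (t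
(t (t (s 13334392) 13334393 o) 13334409 (t (s 13334410) 13334426 o)) 13334616 (t (t (s 13334632) 13334633 o) 13334648 (s 13334649)))) 13334650 (t (t
(t (t (s 13334665) 13334682 o) 13334872 (t (s 13334888) 13334889 o)) 13334905 (t (t (s 13334922) 13335128 o) 13335144 (s 13335161))) 13338249 (t
(t (t (s 13338265) 13338488 o) 13338505 (t (s 13338521) 13338727 o)) 13338728 (t (t (s 13338744) 13338745 o) 13338761 (s 13338762)))))))) 13338777 (t (t (t (t (t (t
(t (t (s 13338983) 13338984 o) 13339000 (t (s 13339001) 13339017 o)) 13339240 (t (t (s 13339256) 13339257 o) 13339273 (t (s 13342617) 13342856 o))) 13342857 (t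
(t (t (s 13342873) 13343079 o) 13343096 (t (s 13343113) 13343336 o)) 13343352 (t (t (s 13343368) 13395833 o) 13395849 (s 13395866)))) 13396088 (t (t
(t (t (s 13399688) 13399689 o) 13399705 (t (s 13399928) 13399944 o)) 13399945 (t (t (s 13399961) 13399962 o) 13400168 (s 13400183))) 13400184 (t
(t (t (s 13400185) 13400200 o) 13400217 (t (s 13400424) 13400440 o)) 13400457 (t (t (s 13400473) 13400696 o) 13404023 (s 13404040))))) 13404057 (t (t (t
(t (t (s 13404073) 13404263 o) 13404279 (t (s 13404280) 13404296 o)) 13404297 (t (t (s 13404313) 13404329 o) 13404519 (t (s 13404535) 13404536 o))) 13404552 (t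
(t (t (s 13404553) 13404569 o) 13404791 (t (s 13404792) 13404808 o)) 13404809 (t (t (s 13408408) 13408648 o) 13408664 (s 13408887)))) 13408888 (t (t
(t (t (s 13408904) 14182280 o) 14182281 (t (s 14182297) 14182520 o)) 14186136 (t (t (s 14186375) 14186376 o) 14186392 (s 14186393))) 14186409 (t
(t (t (s 14186615) 14186632 o) 14186649 (t (s 14186665) 14186871 o)) 14186872 (t (t (s 14186888) 14186889 o) 14186905 (s 14187127)))))) 14187128 (t (t (t (t
(t (t (s 14187144) 14190248 o) 14190471 (t (s 14190487) 14190488 o)) 14190504 (t (t (s 14190505) 14190727 o) 14190744 (t (s 14190761) 14190967 o))) 14190983 (t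
(t (t (s 14190984) 14191000 o) 14191001 (t (s 14191223) 14191239 o)) 14191240 (t (t (s 14191256) 14194600 o) 14194616 (s 14194839)))) 14194856 (t (t
(t (t (s 14195062) 14195078 o) 14195079 (t (s 14195095) 14195096 o)) 14195112 (t (t (s 14195335) 14195351 o) 14251656 (s 14251672))) 14251673 (t
(t (t (s 14251896) 14251912 o) 14251913 (t (s 14251929) 14251945 o)) 14252151 (t (t (s 14252152) 14252168 o) 14252169 (s 14252185))))) 14252407 (t (t (t
(t (t (s 14252408) 14255751 o) 14255767 (t (s 14255768) 14255784 o)) 14255991 (t (t (s 14256007) 14256008 o) 14256024 (t (s 14256025) 14256041 o))) 14256247 (t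
(t (t (s 14256263) 14256264 o) 14256280 (t (s 14256281) 14256297 o)) 14256503 (t (t (s 14256519) 14256520 o) 14256536 (s 14256537)))) 14256759 (t (t
(t (t (s 14256776) 14259880 o) 14259896 (t (s 14260102) 14260103 o)) 14260119 (t (t (s 14260120) 14260136 o) 14260342 (s 14260358))) 14260359 (t
(t (t (s 14260375) 14260376 o) 14260392 (t (s 14260598) 14260615 o)) 14260631 (t (t (s 14260632) 14260855 o) 14260871 (s 14260872))))))) 14264232 (t (t (t (t (t
(t (t (s 14264471) 14264694 o) 14264710 (t (s 14264727) 14264743 o)) 14378873 (t (t (s 14378889) 14378906 o) 14379112 (t (s 14382728) 14382745 o))) 14382968 (t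
(t (t (s 14382984) 14382985 o) 14383001 (t (s 14383002) 14383224 o)) 14383241 (t (t (s 14383258) 14383464 o) 14383480 (s 14383481)))) 14383497 (t (t
(t (t (s 14383720) 14383736 o) 14386823 (t (s 14386840) 14387063 o)) 14387079 (t (t (s 14387080) 14387096 o) 14387097 (s 14387113))) 14387319 (t
(t (t (s 14387336) 14387353 o) 14387559 (t (s 14387575) 14387576 o)) 14387592 (t (t (s 14387593) 14387609 o) 14387832 (s 14387848))))) 14387849 (t (t (t
(t (t (s 14390952) 14391175 o) 14391191 (t (s 14391192) 14391208 o)) 14391414 (t (t (s 14391431) 14391448 o) 14391670 (t (s 14391671) 14391687 o))) 14391688 (t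
(t (t (s 14391704) 14391927 o) 14391944 (t (s 14395766) 14395783 o)) 14395799 (t (t (s 14444424) 14444441 o) 14448280 (s 14448519)))) 14448520 (t (t
(t (t (s 14448536) 14448537 o) 14448553 (t (s 14448759) 14448776 o)) 14448793 (t (t (s 14449015) 14449016 o) 14449032 (s 14449271))) 14452375 (t
(t (t (s 14452392) 14452615 o) 14452631 (t (s 14452632) 14452648 o)) 14452649 (t (t (s 14452871) 14452888 o) 14452905 (s 14453111)))))) 14453127 (t (t (t (t
(t (t (s 14453128) 14453144 o) 14453367 (t (s 14453383) 14453384 o)) 14453400 (t (t (s 14456504) 14456727 o) 14456743 (t (s 14456744) 14456760 o))) 14456966 (t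
(t (t (s 14456983) 14457000 o) 14457206 (t (s 14457222) 14457223 o)) 14457239 (t (t (s 14457240) 14457256 o) 14457479 (s 14461318)))) 14461335 (t (t
(t (t (s 14461351) 14706537 o) 14706553 (t (s 14710409) 14710632 o)) 14710648 (t (t (s 14710649) 14710665 o) 14710666 (s 14710682))) 14710888 (t
(t (t (s 14710905) 14710922 o) 14711128 (t (s 14711144) 14711145 o)) 14711161 (t (t (s 14711384) 14714744 o) 14714760 (s 14714761))))) 14714777 (t (t (t
(t (t (s 14714983) 14715000 o) 14715017 (t (s 14715239) 14715240 o)) 14715256 (t (t (s 14715257) 14715273 o) 14715496 (t (s 14715513) 14719129 o))) 14719352 (t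
(t (t (s 14719368) 14719369 o) 14719608 (t (s 14775929) 14775945 o)) 14775946 (t (t (s 14776168) 14776169 o) 14776185 (s 14776202)))) 14776408 (t (t
(t (t (s 14776424) 14776425 o) 14776441 (t (s 14776664) 14780024 o)) 14780040 (t (t (s 14780041) 14780057 o) 14780264 (s 14780280))) 14780281 (t
(t (t (s 14780297) 14780519 o) 14780520 (t (s 14780536) 14780537 o)) 14780553 (t (t (s 14780554) 14780776 o) 14780793 (s 14781032))))))))) 14781049 (t (t (t (t (t (t (t
(t (t (s 14784376) 14784392 o) 14784393 (t (s 14784409) 14784615 o)) 14784632 (t (t (s 14784648) 14784649 o) 14784665 (t (s 14784871) 14784872 o))) 14784888 (t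
(t (t (s 14784905) 14785128 o) 14785144 (t (s 14788984) 14789000 o)) 14907001 (t (t (s 14907018) 14907241 o) 14907257 (s 14907258)))) 14907274 (t (t
(t (t (s 14907480) 14907497 o) 14907514 (t (s 14907737) 14907753 o)) 14911096 (t (t (s 14911113) 14911336 o) 14911353 (s 14911369))) 14911370 (t
(t (t (s 14911592) 14911609 o) 14911626 (t (s 14911832) 14911848 o)) 14911849 (t (t (s 14911865) 14912088 o) 14912105 (s 14915465))))) 14915481 (t (t (t
(t (t (s 14915704) 14915721 o) 14915943 (t (s 14915944) 14915960 o)) 14915961 (t (t (s 14915977) 14916200 o) 14920056 (t (s 14972553) 14972776 o))) 14972792 (t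
(t (t (s 14972793) 14972809 o) 14972810 (t (s 14972826) 14973032 o)) 14973049 (t (t (s 14973272) 14973288 o) 14976648 (s 14976665)))) 14976888 (t (t
(t (t (s 14976904) 14976905 o) 14976921 (t (s 14977127) 14977144 o)) 14977161 (t (t (s 14977383) 14977384 o) 14977400 (s 14977417))) 14977640 (t
(t (t (s 14977657) 14981017 o) 14981256 (t (s 14981273) 14981479 o)) 14981495 (t (t (s 14981496) 14981512 o) 14981513 (s 14981752)))))) 14985608 (t (t (t (t
(t (t (s 16807560) 16807561 o) 16807800 (t (s 16811655) 16811672 o)) 16811895 (t (t (s 16811911) 16811912 o) 16811928 (t (s 16811929) 16811945 o))) 16812135 (t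
(t (t (s 16812151) 16812152 o) 16812168 (t (s 16812391) 16812408 o)) 16816040 (t (t (s 16816263) 16816280 o) 16816296 (s 16816502)))) 16816503 (t (t
(t (t (s 16816519) 16816520 o) 16816536 (t (s 16816759) 16816775 o)) 16816776 (t (t (s 16877176) 16877191 o) 16877192 (s 16877208))) 16877209 (t
(t (t (s 16877431) 16877432 o) 16877448 (t (s 16877671) 16877688 o)) 16881287 (t (t (s 16881304) 16881320 o) 16881527 (s 16881543))))) 16881544 (t (t (t
(t (t (s 16881560) 16881561 o) 16881576 (t (s 16881782) 16881783 o)) 16881799 (t (t (s 16881800) 16881816 o) 16881817 (t (s 16882023) 16882038 o))) 16882039 (t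
(t (t (s 16882056) 16885672 o) 16885895 (t (s 16885911) 16885912 o)) 16886134 (t (t (s 16886151) 16886152 o) 16886167 (s 17004153)))) 17004392 (t (t
(t (t (s 17008248) 17008264 o) 17008265 (t (s 17008281) 17008503 o)) 17008504 (t (t (s 17008520) 17008521 o) 17008537 (s 17008743))) 17008760 (t
(t (t (s 17012376) 17012599 o) 17012615 (t (s 17012616) 17012632 o)) 17012633 (t (t (s 17012839) 17012855 o) 17012856 (s 17012872))))))) 17012889 (t (t (t (t (t
(t (t (s 17013095) 17013111 o) 17013112 (t (s 17013128) 17013129 o)) 17013367 (t (t (s 17013368) 17016967 o) 17016984 (t (s 17017207) 17017223 o))) 17017224 (t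
(t (t (s 17073799) 17073816 o) 17074039 (t (s 17074055) 17074056 o)) 17074072 (t (t (s 17074073) 17074295 o) 17077928 (s 17078151)))) 17078167 (t (t
(t (t (s 17078168) 17078184 o) 17078390 (t (s 17078407) 17078424 o)) 17078646 (t (t (s 17078647) 17078663 o) 17078664 (s 17078680))) 17078903 (t
(t (t (s 17082775) 17328008 o) 17328009 (t (s 17328025) 17328248 o)) 17328264 (t (t (s 17328504) 17331864 o) 17332103 (s 17332104))))) 17332120 (t (t (t
(t (t (s 17332121) 17332137 o) 17332343 (t (s 17332344) 17332359 o)) 17332360 (t (t (s 17332361) 17332376 o) 17332377 (t (s 17332393) 17332599 o))) 17332600 (t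
(t (t (s 17332615) 17332616 o) 17332632 (t (s 17332633) 17332649 o)) 17332855 (t (t (s 17332872) 17336455 o) 17336472 (s 17336489)))) 17336711 (t (t
(t (t (s 17336712) 17336728 o) 17336729 (t (s 17336951) 17336952 o)) 17336967 (t (t (s 17336968) 17336984 o) 17340840 (s 17341063))) 17393544 (t
(t (t (s 17393784) 17397384 o) 17397385 (t (s 17397400) 17397401 o)) 17397624 (t (t (s 17397639) 17397640 o) 17397641 (s 17397656)))))) 17397657 (t (t (t (t
(t (t (s 17397673) 17397879 o) 17397880 (t (s 17397895) 17397896 o)) 17397912 (t (t (s 17397913) 17398135 o) 17398152 (t (s 17401479) 17401496 o))) 17401735 (t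
(t (t (s 17401736) 17401752 o) 17401753 (t (s 17401769) 17401959 o)) 17401975 (t (t (s 17401976) 17401991 o) 17401992 (s 17402008)))) 17402009 (t (t
(t (t (s 17402025) 17402215 o) 17402231 (t (s 17402232) 17402247 o)) 17402248 (t (t (s 17402264) 17402265 o) 17402487 (s 17402488))) 17402503 (t
(t (t (s 17402504) 17402520 o) 17406087 (t (s 17406104) 17406120 o)) 17406343 (t (t (s 17406344) 17406360 o) 17406583 (s 17406599))))) 17406600 (t (t (t
(t (t (s 17524601) 17524617 o) 17524634 (t (s 17524856) 17528456 o)) 17528457 (t (t (s 17528473) 17528696 o) 17528712 (t (s 17528713) 17528729 o))) 17528730 (t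
(t (t (s 17528936) 17528951 o) 17528952 (t (s 17528953) 17528968 o)) 17528985 (t (t (s 17529192) 17529208 o) 17529225 (s 17529241)))) 17529464 (t (t
(t (t (s 17532791) 17532808 o) 17532825 (t (s 17532841) 17533031 o)) 17533047 (t (t (s 17533048) 17533064 o) 17533065 (s 17533081))) 17533097 (t
(t (t (s 17533287) 17533303 o) 17533304 (t (s 17533320) 17533321 o)) 17533337 (t (t (s 17533559) 17533560 o) 17533576 (s 17533577)))))))) 17537176 (t (t (t (t (t (t
(t (t (s 17537416) 17537432 o) 17537655 (t (s 17537656) 17537672 o)) 17590152 (t (t (s 17590169) 17593992 o) 17594008 (t (s 17594009) 17594247 o))) 17594248 (t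
(t (t (s 17594264) 17594265 o) 17594281 (t (s 17594487) 17594488 o)) 17594503 (t (t (s 17594520) 17594537 o) 17594743 (s 17594760)))) 17594776 (t (t
(t (t (s 17594999) 17598360 o) 17598377 (t (s 17598599) 17598616 o)) 17598633 (t (t (s 17598839) 17598855 o) 17598856 (s 17598872))) 17598873 (t
(t (t (s 17599095) 17599111 o) 17599112 (t (s 17599128) 17602728 o)) 17602984 (t (t (s 17603207) 18376584 o) 18376600 (s 18376617))))) 18380456 (t (t (t
(t (t (s 18380679) 18380695 o) 18380696 (t (s 18380712) 18380713 o)) 18380935 (t (t (s 18380952) 18380968 o) 18380969 (t (s 18381175) 18381191 o))) 18381192 (t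
(t (t (s 18381208) 18381431 o) 18381447 (t (s 18384568) 18384790 o)) 18384791 (t (t (s 18384807) 18384808 o) 18384824 (s 18385030)))) 18385047 (t (t
(t (t (s 18385064) 18385286 o) 18385303 (t (s 18385320) 18385543 o)) 18385559 (t (t (s 18385560) 18389159 o) 18389176 (s 18389382))) 18389398 (t
(t (t (s 18389399) 18389415 o) 18389416 (t (s 18389638) 18389654 o)) 18389655 (t (t (s 18445976) 18445992 o) 18446215 (s 18446216)))))) 18446232 (t (t (t (t
(t (t (s 18446248) 18446249 o) 18446455 (t (s 18446471) 18446472 o)) 18446488 (t (t (s 18446711) 18450071 o) 18450087 (t (s 18450088) 18450104 o))) 18450327 (t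
(t (t (s 18450344) 18450566 o) 18450567 (t (s 18450583) 18450584 o)) 18450600 (t (t (s 18450601) 18450823 o) 18450839 (s 18450840)))) 18450856 (t (t
(t (t (s 18451079) 18451096 o) 18454200 (t (s 18454406) 18454422 o)) 18454423 (t (t (s 18454439) 18454440 o) 18454456 (s 18454662))) 18454678 (t
(t (t (s 18454679) 18454695 o) 18454696 (t (s 18454712) 18454918 o)) 18454934 (t (t (s 18454935) 18454952 o) 18455174 (s 18455175))))) 18455191 (t (t (t
(t (t (s 18458791) 18459030 o) 18459047 (t (s 18573192) 18573209 o)) 18577048 (t (t (s 18577287) 18577288 o) 18577304 (t (s 18577305) 18577321 o))) 18577527 (t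
(t (t (s 18577544) 18577561 o) 18577783 (t (s 18577784) 18577800 o)) 18578039 (t (t (s 18581143) 18581160 o) 18581383 (s 18581399)))) 18581400 (t (t
(t (t (s 18581416) 18581417 o) 18581639 (t (s 18581656) 18581673 o)) 18581879 (t (t (s 18581895) 18581896 o) 18581912 (s 18582135))) 18582151 (t
(t (t (s 18582152) 18582168 o) 18585272 (t (s 18585495) 18585511 o)) 18585512 (t (t (s 18585528) 18585734 o) 18585751 (s 18585768))))))) 18585974 (t (t (t (t (t
(t (t (s 18585990) 18585991 o) 18586007 (t (s 18586008) 18586024 o)) 18586247 (t (t (s 18590086) 18590103 o) 18590119 (t (s 18638744) 18642600 o))) 18642823 (t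
(t (t (s 18642839) 18642840 o) 18642856 (t (s 18642857) 18643079 o)) 18643096 (t (t (s 18643319) 18643335 o) 18646695 (s 18646712)))) 18646934 (t (t
(t (t (s 18646935) 18646951 o) 18646968 (t (s 18647174) 18647191 o)) 18647208 (t (t (s 18647430) 18647447 o) 18647464 (s 18647687))) 18647703 (t
(t (t (s 18647704) 18651047 o) 18651063 (t (s 18651064) 18651286 o)) 18651303 (t (t (s 18651320) 18651526 o) 18651542 (s 18651543))))) 18651559 (t (t (t
(t (t (s 18651782) 18651799 o) 18904712 (t (s 18904729) 18904952 o)) 18904968 (t (t (s 18904969) 18904985 o) 18904986 (t (s 18905208) 18905225 o))) 18905448 (t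
(t (t (s 18905464) 18909064 o) 18909080 (t (s 18909081) 18909097 o)) 18909303 (t (t (s 18909320) 18909337 o) 18909543 (s 18909559)))) 18909560 (t (t
(t (t (s 18909576) 18909593 o) 18909816 (t (s 18909833) 18913672 o)) 18913688 (t (t (s 18913911) 18913928 o) 18970248 (s 18970249))) 18970265 (t
(t (t (s 18970472) 18970488 o) 18970505 (t (s 18970728) 18970744 o)) 18974344 (t (t (s 18974360) 18974361 o) 18974583 (s 18974584)))))) 18974600 (t (t (t (t
(t (t (s 18974617) 18974823 o) 18974839 (t (s 18974840) 18974856 o)) 18974857 (t (t (s 18974873) 18975079 o) 18975096 (t (s 18975113) 18975352 o))) 18978696 (t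
(t (t (s 18978712) 18978713 o) 18978935 (t (s 18978952) 18978968 o)) 18978969 (t (t (s 18979175) 18979191 o) 18979208 (s 18979224)))) 18979447 (t (t
(t (t (s 18979448) 18979464 o) 19101321 (t (s 19101544) 19101560 o)) 19101561 (t (t (s 19101577) 19101578 o) 19101594 (s 19101800))) 19101817 (t
(t (t (s 19102040) 19102056 o) 19105416 (t (s 19105433) 19105656 o)) 19105672 (t (t (s 19105673) 19105689 o) 19105895 (s 19105912))))) 19105929 (t (t (t
(t (t (s 19106151) 19106152 o) 19106168 (t (s 19106185) 19106408 o)) 19106425 (t (t (s 19109785) 19110024 o) 19110041 (t (s 19110247) 19110263 o))) 19110264 (t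
(t (t (s 19110280) 19110281 o) 19110520 (t (s 19114376) 19166856 o)) 19166873 (t (t (s 19167096) 19167112 o) 19167113 (s 19167129)))) 19167352 (t (t
(t (t (s 19170968) 19171191 o) 19171208 (t (s 19171224) 19171225 o)) 19171241 (t (t (s 19171447) 19171464 o) 19171481 (s 19171687))) 19171703 (t
(t (t (s 19171720) 19171737 o) 19171960 (t (s 19175576) 19175799 o)) 19175815 (t (t (s 19175816) 19175832 o) 19176055 (s 19176072)))))))))))

noncomputable def treeB : KT :=
  (t (t (t (t (t (t (t
(t (s 2290649224) 6585620360 (s 15175551097)) 19470518392 (t (s 19470518408) 41197009288 o)) 49786947960 (t (t (s 54081915271) 54098692231 o) 105368881303 (t (s 109663848599) 122548750487 o))) 144024565881 (t (t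
(t (s 144024569992) 152613456009 (s 156909471880)) 311276632456 (t (s 311528294536) 315571603592 o)) 315823261832 (t (t (s 324161534073) 324413196424 o) 328456501384 (t (s 328456501640) 328456509575 o)))) 328708163704 (t (t (t
(t (s 328708163720) 328708163960 (s 379726694552)) 379995125896 (t (s 380247771287) 384021661848 o)) 384021665703 (t (t (s 384542742423) 384558466968 o) 384558471079 (t (s 384559519639) 392611596424 o))) 392611596440 (t
(t (t (s 393132673160) 393149454231 o) 396906563735 (t (s 396906563736) 397174995080 o)) 397175978120 (t (t (s 397175986071) 397427640471 o) 397443372967 (t (s 397444421527) 414338025609 o))))) 414355847289 (t (t (t (t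
(t (s 414372624521) 414624282745 (s 427240749177)) 427240757112 (t (s 427492345993) 427509127049 o)) 431517894793 (t (t (s 431804094360) 826925353081 o) 831220328328 (t (s 843836856440) 861015669113 o))) 861285091464 (t (t
(t (s 861285149049) 865580058760 (s 878464960648)) 968390899833 (t (s 968390907784) 1135892593032 o)) 1135892597128 (t (t (s 1135893641864) 1136162076792 o) 1140187564168 (t (s 1140187564424) 1140188608904 o)))) 1140456982664 (t (t (t
(t (s 1148777499016) 1149046917256 (s 1153072466312)) 1209176528791 (t (s 1239241230472) 1243536197768 o)) 1243536201608 (t (t (s 1256421099656) 2201565563016 o) 2205860534152 (t (s 2214450464889) 2218745432200 o))) 2248810195321 (t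
(t (t (s 2304913213591) 2309208180887 o) 2321823598743 (t (s 2322093082775) 2343316256889 o)) 2351636711561 (t (t (s 2351889352841) 2356184385672 o) 2475940157320 (t (s 2488825055353) 2488825059208 o)))))) 2489076717432 (t (t (t (t (t
(t (s 2493120026504) 2493371680888 (s 2493371684743)) 2493388457848 (t (s 2510551546248) 2510551550088 o)) 2514846517384 (t (t (s 2523436447865) 2523436451976 o) 2523453220985 (t (s 2523453225096) 2527731415176 o))) 2527731415432 (t (t
(t (s 2527731419256) 2527731419272 (s 2527731419512)) 2527731423367 (t (s 2579271026839) 2583565997975 o)) 2583582775191 (t (t (s 2583850157976) 2591886510216 o) 2591887493256 (t (s 2592155928712) 2592172701832 o)))) 2592172709783 (t (t (t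
(t (s 2596181477527) 2596182460567 (s 2596450891912)) 2596450896023 (t (s 2596450899863) 2596467677079 o)) 2613379102857 (t (t (s 2613630761081) 2613630765192 o) 2613647538297 (t (s 2626264012680) 2626514618505 o))) 2626515662969 (t
(t (t (s 2626515670904) 2626531399561 o) 2626784040841 (t (s 2630541150345) 2630558979976 o)) 2630810634360 (t (t (s 2630810634376) 2630826366856 o) 2630826366872 (t (s 2630827411320) 2631079008152 o))))) 3025948608633 (t (t (t (t
(t (s 3030243583880) 3042860111992 (s 3060291635576)) 3060308404601 (t (s 3060560005256) 3060560005512 o)) 3060561045881 (t (t (s 3060561054072) 3064586606968 o) 3064854972552 (t (s 3064854972808) 3073176541560 o))) 3077471500920 (t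
(t (t (s 3077471504760) 3077739874440 o) 3077739874680 (t (s 3077739874696) 3077740923256 o)) 3133053368457 (t (t (s 3133053433992) 3133053438088 o) 3133053441943 (t (s 3133321803913) 3133321808008 o)))) 3133321811863 (t (t (t
(t (s 3133574445193) 3133574449288 (s 3133574453143)) 3141643307144 (t (s 3141643372680) 3141911742600 o)) 3142164383880 (t (t (s 3163639220361) 3167414159481 o) 3167934187641 (t (s 3167934187657) 3167935232121 o))) 3167935240072 (t
(t (t (s 3180819089545) 3300556114056 o) 3300825532552 (t (s 3304851085448) 3313441020040 o)) 3313442064504 (t (t (s 3348054506104) 3403635325080 o) 3404156401816 (t (s 3407930300327) 3408198727832 o))))))) 3408198735767 (t (t (t (t (t (t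
(t (s 3408199784343) 3408451377063 (s 3416519182488)) 3420815198359 (t (s 3421335226519) 3438264486024 o)) 3438516144264 (t (t (s 3442559453320) 3442811115400 o) 3451148339337 (t (s 3455444355208) 3455696013448 o))) 6599359432840 (t (t
(t (s 6603654403976) 6612244334713 (s 6616539302024)) 6638014134664 (t (s 6638265731208) 6638266775944 o)) 6646604065145 (t (t (s 6646604073336) 6646873483641 o) 6650899040647 (t (s 6741093283977) 6741362767993 o)))) 6874254055304 (t (t (t
(t (s 6878012217224) 6886602147961 (s 6886602152072)) 6887138953337 (t (s 6891433924488) 6908328638856 o)) 6908598061192 (t (t (s 6912355174792) 6912623609992 o) 6912624593288 (t (s 6912893028488) 6921214531960 o))) 6921482963080 (t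
(t (t (s 6921767123080) 6925508512120 o) 6925509499271 (t (s 6925777930376) 6925777930616 o)) 6981896669080 (t (t (s 7011677276296) 7011694049401 o) 7015736313753 (t (s 7024577910665) 7028857145480 o))))) 7028872877960 (t (t (t (t
(t (s 7028872877976) 7458353867129 (s 7458353875080)) 7458354915705 (t (s 7458606516616) 7462380407176 o)) 7462648838265 (t (t (s 7462648838280) 7462648842376 o) 7462901483912 (t (s 7475533744264) 7475786385784 o))) 7475786385800 (t
(t (t (s 7531368315016) 7531368315017 o) 7531368319112 (t (s 7531368322967) 7539958253704 o)) 7565729101929 (t (t (s 7698872109176) 7703167076472 o) 7703167080327 (t (s 7732962359688) 7733231847559 o)))) 7733482387848 (t (t (t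
(t (s 7733483506055) 7737257330824 (s 7737526814840)) 7737777358984 (t (s 7737778403720) 7737778473336 o)) 7737778477191 (t (t (s 7746368407928) 7750663375239 o) 7840606029944 (t (s 8798382622856) 8798383671432 o))) 8802678642568 (t
(t (t (s 8811268573305) 8815562492024 o) 8815562492040 (t (s 8815563540600) 8815563540616 o)) 8837020551560 (t (t (s 8837037328520) 8837289969800 o) 8837290031496 (t (s 8845879970168) 8850174937479 o)))))) 8850191714439 (t (t (t (t (t
(t (s 8901730269336) 8906025236632 (s 8918910138520)) 9073261516936 (t (s 9073278293896) 9086163191929 o)) 9090441386120 (t (t (s 9090458163080) 9107352877448 o) 9107369654664 (t (s 9107620268168) 9107621316744 o))) 9107637045384 (t (t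
(t (s 9107889682824) 9111647848584 (s 9111664625800)) 9111915235464 (t (s 9111916284040) 9111932012680 o)) 9112184653960 (t (t (s 9120506218632) 9120521943161 o) 9120521947272 (t (s 9120791361672) 9124532750712 o)))) 9124549523848 (t (t (t
(t (s 9124549531783) 9124800137336 (s 9124800137352)) 9124801185912 (t (s 9124801185928) 9124801186168 o)) 9124816910472 (t (t (s 9124816914568) 9125069552008 o) 9125069559943 (t (s 9176340793495) 9180399830936 o))) 9180635764631 (t
(t (t (s 9180651489176) 9180651493271 o) 9180651493287 (t (s 9180652541847) 9189225695368 o)) 9189241427863 (t (t (s 9189242476439) 9193520662679 o) 9193536395159 (t (s 9193536395175) 9193537443735 o))))) 9210717304953 (t (t (t (t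
(t (s 9223602149257) 9227897116552 (s 9227897116568)) 9623018375289 (t (s 9627313346424) 9627313350536 o)) 9639929878648 (t (t (s 9657108691321) 9657108691336 o) 9657378105721 (t (s 9657378113672) 9657378171257 o))) 9657629768072 (t
(t (t (s 9657629772168) 9657630820728 o) 9661403662472 (t (s 9661673076857) 9661673076872 o)) 9661673080968 (t (t (s 9661924739208) 9661924739464 o) 9674557982856 (t (s 9674809641336) 9674809641352 o)))) 9674810689912 (t (t (t
(t (s 9764752291961) 9764752299896 (s 9897895299208)) 9902190270344 (t (s 9932255099000) 9932507744647 o)) 9936532179336 (t (t (s 9936548956296) 9936550004872 o) 9936550066296 (t (s 9936801659272) 9936801663352 o))) 9936802711928 (t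
(t (t (s 9936802715783) 9945139939464 o) 9945391597944 (t (s 9945392646520) 9949686565255 o)) 9949687613831 (t (t (s 10005269550999) 10035334252680 o) 10039629219976 (t (s 10039629223816) 10052514121864 o))))))))
end KT

/-! ### Vectors -/

/-- Integer vectors indexed by the letters 0, 1, 3, 4. -/
@[ext] structure V4 where
  c0 : ℤ
  c1 : ℤ
  c3 : ℤ
  c4 : ℤ

/-- Evaluate the argument before applying a function (for kernel reduction). -/
def forceN (n : ℕ) (f : ℕ → Bool) : Bool := Nat.rec (f 0) (fun m _ => f (Nat.succ m)) n

theorem forceN_eq (n : ℕ) (f : ℕ → Bool) : forceN n f = f n := by cases n <;> rfl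

/-- Evaluate an integer argument before applying a function. -/
def forceI (z : ℤ) (f : ℤ → Bool) : Bool :=
  Int.rec (fun n => forceN n fun m => f (Int.ofNat m)) (fun n => forceN n fun m => f (Int.negSucc m)) z

theorem forceI_eq (z : ℤ) (f : ℤ → Bool) : forceI z f = f z := by
  cases z
  · exact forceN_eq _ (fun m => f (Int.ofNat m))
  · exact forceN_eq _ (fun m => f (Int.negSucc m))

/-- Parent of a second difference `u`, when the digit contribution is `(p,0,0,q)`. -/
def up (u : V4) (p q : ℤ) : V4 :=
  ⟨u.c3 - (u.c4 - q), u.c4 - q, u.c1 - (u.c0 - p - (u.c3 - (u.c4 - q))),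
    u.c0 - p - (u.c3 - (u.c4 - q))⟩

/-- The same as `up` then applying `f`, in a form which is fast to reduce in the kernel. -/
def upk (u : V4) (p q : ℤ) (f : V4 → Bool) : Bool :=
  forceI (Int.sub u.c4 q) fun x1 => forceI (Int.sub u.c3 x1) fun x0 =>
    forceI (Int.sub (Int.sub u.c0 p) x0) fun x4 => forceI (Int.sub u.c1 x4) fun x3 =>
      f ⟨x0, x1, x3, x4⟩

theorem upk_eq (u : V4) (p q : ℤ) (f : V4 → Bool) : upk u p q f = f (up u p q) := by
  simp only [upk, forceI_eq]
  rfl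

/-- The linear map of φ plus the digit contribution. -/
def down (x : V4) (p q : ℤ) : V4 :=
  ⟨x.c0 + x.c4 + p, x.c3 + x.c4, x.c0 + x.c1, x.c1 + q⟩

theorem up_down (x : V4) (p q : ℤ) : up (down x p q) p q = x := by
  ext <;> simp [up, down]

/-- The indefinite quadratic form controlling the contracting directions. -/
def qf (x : V4) : ℤ :=
  x.c0 * (15 * x.c0 - 22 * x.c1 - 22 * x.c3 + 10 * x.c4) + x.c1 * (8 * x.c3 - 8 * x.c4 - x.c1)
    + x.c3 * (8 * x.c3 - 28 * x.c4) + 8 * (x.c4 * x.c4)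

/-- The test `507 < qf x`, in a form which is fast to reduce in the kernel. -/
def qbig (x : V4) : Bool :=
  forceI (Int.add (Int.sub (Int.mul (Int.ofNat 15) x.c0) (Int.mul (Int.ofNat 22) x.c1))
      (Int.sub (Int.mul (Int.ofNat 10) x.c4) (Int.mul (Int.ofNat 22) x.c3))) fun a =>
  forceI (Int.sub (Int.mul (Int.ofNat 8) (Int.sub x.c3 x.c4)) x.c1) fun b =>
  forceI (Int.sub (Int.mul (Int.ofNat 8) x.c3) (Int.mul (Int.ofNat 28) x.c4)) fun c =>
  Int.rec (fun n => Nat.ble 508 n) (fun _ => false)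
    (Int.add (Int.add (Int.mul x.c0 a) (Int.mul x.c1 b))
      (Int.add (Int.mul x.c3 c) (Int.mul (Int.ofNat 8) (Int.mul x.c4 x.c4))))

theorem lt_of_qbig (x : V4) (h : qbig x = true) : 507 < qf x := by
  simp only [qbig, forceI_eq] at h
  have key : ∀ z : ℤ, @Int.rec (fun _ => Bool) (fun n => Nat.ble 508 n) (fun _ => false) z = true →
      507 < z := by
    intro z hz
    cases z with
    | ofNat n =>
      have hz' : Nat.ble 508 n = true := hz
      rw [Nat.ble_eq] at hz'
      simp only [Int.ofNat_eq_natCast]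
      omega
    | negSucc n => exact absurd hz (by simp)
  have h2 := key _ h
  have h3 : qf x = (x.c0 * ((15 * x.c0 - 22 * x.c1) + (10 * x.c4 - 22 * x.c3))
      + x.c1 * (8 * (x.c3 - x.c4) - x.c1)) + (x.c3 * (8 * x.c3 - 28 * x.c4)
      + 8 * (x.c4 * x.c4)) := by
    unfold qf
    ring
  rw [h3]
  exact h2

/-- Evaluate a vector argument before applying a function. -/
def forceV (u : V4) (f : V4 → Bool) : Bool :=
  forceI u.c0 fun a => forceI u.c1 fun b => forceI u.c3 fun c => forceI u.c4 fun d => f ⟨a, b, c, d⟩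

theorem forceV_eq (u : V4) (f : V4 → Bool) : forceV u f = f u := by
  simp [forceV, forceI_eq]

/-- Test `-8 ≤ z < 8`. -/
def small (z : ℤ) : Bool :=
  match Int.add z (Int.ofNat 8) with
  | Int.ofNat n => Nat.ble n 15
  | Int.negSucc _ => false

/-- Digit of `z`. -/
def dig (z : ℤ) : ℕ := (z + 8).toNat

def box (u : V4) : Bool :=
  bif small u.c0 then bif small u.c1 then bif small u.c3 then small u.c4
    else false else false else false

def code (u : V4) : ℕ := ((dig u.c0 * 16 + dig u.c1) * 16 + dig u.c3) * 16 + dig u.c4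

def undig (n : ℕ) : ℤ := Int.subNatNat (n % 16) 8

def decode (n : ℕ) : V4 :=
  ⟨undig (n / 4096), undig (n / 256), undig (n / 16), undig n⟩

theorem small_iff (z : ℤ) : small z = true ↔ -8 ≤ z ∧ z < 8 := by
  unfold small
  split
  · rename_i n h
    rw [Nat.ble_eq]
    have h' : z + 8 = (n : ℤ) := h
    omega
  · rename_i n h
    have h1 : z + 8 = Int.negSucc n := h
    have h' : z + 8 = -((n : ℤ) + 1) := by rw [h1, Int.negSucc_eq]
    simp
    omega

theorem undig_eq (n : ℕ) (z : ℤ) (h : ((n % 16 : ℕ) : ℤ) = z + 8) : undig n = z := by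
  unfold undig
  rw [Int.subNatNat_eq_coe]
  push_cast at h ⊢
  omega

theorem box_iff (u : V4) : box u = true ↔
    (-8 ≤ u.c0 ∧ u.c0 < 8) ∧ (-8 ≤ u.c1 ∧ u.c1 < 8) ∧ (-8 ≤ u.c3 ∧ u.c3 < 8) ∧
      (-8 ≤ u.c4 ∧ u.c4 < 8) := by
  unfold box
  rw [← small_iff, ← small_iff, ← small_iff, ← small_iff]
  cases small u.c0 <;> cases small u.c1 <;> cases small u.c3 <;> simp

theorem decode_code (u : V4) (h : box u = true) (m : ℕ) : decode (m * 65536 + code u) = u := by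
  rw [box_iff] at h
  unfold decode code dig
  ext
  all_goals
    simp only
    apply undig_eq
    omega

theorem code_lt (u : V4) (h : box u = true) : code u < 65536 := by
  rw [box_iff] at h
  unfold code dig
  omega

/-- Membership in the finite set `U`. -/
def memU (u : V4) : Bool := bif box u then forceN (code u) (KT.mem KT.treeU) else false

/-- Membership in the finite set of triple states. -/
def memR (a b c : ℕ) (u : V4) : Bool :=
  bif box u then forceN (((a * 8 + b) * 8 + c) * 65536 + code u) (KT.mem KT.treeR) else false

/-- Membership in the finite set of quadruple states. -/
def memB (a b c d : ℕ) (u v : V4) : Bool :=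
  bif box u then bif box v then
    forceN (((((a * 8 + b) * 8 + c) * 8 + d) * 65536 + code u) * 65536 + code v)
      (KT.mem KT.treeB)
  else false else false

/-- Possible digit contributions of second differences. -/
def deltas : List (ℤ × ℤ) :=
  [(.negSucc 1, .ofNat 0), (.negSucc 1, .ofNat 1), (.negSucc 1, .ofNat 2),
    (.negSucc 0, .ofNat 0), (.negSucc 0, .ofNat 1), (.ofNat 0, .negSucc 1),
    (.ofNat 0, .negSucc 0), (.ofNat 0, .ofNat 0), (.ofNat 0, .ofNat 1),
    (.ofNat 0, .ofNat 2), (.ofNat 1, .negSucc 1), (.ofNat 1, .negSucc 0),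
    (.ofNat 1, .ofNat 0), (.ofNat 1, .ofNat 1), (.ofNat 2, .negSucc 1),
    (.ofNat 2, .ofNat 0)]

/-- Kernel friendly universal quantifier over lists. -/
def lall {α : Type} (p : α → Bool) (l : List α) : Bool :=
  List.rec true (fun a _ ih => bif p a then ih else false) l

theorem lall_iff {α : Type} (p : α → Bool) (l : List α) :
    lall p l = true ↔ ∀ a ∈ l, p a = true := by
  induction l with
  | nil => simp [lall]
  | cons a l ih =>
    have : lall p (a :: l) = (bif p a then lall p l else false) := rfl
    rw [this]
    cases h : p a <;> simp [h, ih]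

/-- `x` is in `U`, or violates the quadratic bound. -/
def okU (x : V4) : Bool := bif memU x then true else qbig x

/-- Children of a letter, with digit contributions to the letters 0 and 4. -/
def chl : ℕ → List (ℕ × ℤ × ℤ)
  | 0 => [(0, 0, 0), (3, 1, 0)]
  | 1 => [(4, 0, 0), (3, 0, 1)]
  | 3 => [(1, 0, 0)]
  | 4 => [(0, 0, 0), (1, 1, 0)]
  | _ => []

/-- Parents of a letter, with digit contributions. -/
def parl : ℕ → List (ℕ × ℤ × ℤ)
  | 0 => [(0, 0, 0), (4, 0, 0)]
  | 1 => [(3, 0, 0), (4, 1, 0)]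
  | 3 => [(0, 1, 0), (1, 0, 1)]
  | 4 => [(1, 0, 0)]
  | _ => []

/-- Closure of `U` under taking parents. -/
def checkU (n : ℕ) : Bool := forceV (decode n) fun u => lall (fun d => upk u d.1 d.2 okU) deltas

/-- Zero length and zero sum. -/
def ker (u : V4) : Bool :=
  decide (u.c0 + u.c1 + u.c3 + u.c4 = 0) && decide (u.c1 + 3 * u.c3 + 4 * u.c4 = 0)

/-- The three possible values of a second difference of an additive square. -/
def kerVals : List V4 := [⟨0, 0, 0, 0⟩, ⟨1, -2, 2, -1⟩, ⟨-1, 2, -2, 1⟩]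

def eqV (u v : V4) : Bool :=
  decide (u.c0 = v.c0) && decide (u.c1 = v.c1) && decide (u.c3 = v.c3) && decide (u.c4 = v.c4)

def checkR' (a b c : ℕ) (u : V4) : Bool :=
  (bif ker u then eqV u ⟨0, 0, 0, 0⟩ || eqV u ⟨1, -2, 2, -1⟩ || eqV u ⟨-1, 2, -2, 1⟩ else true) &&
  lall (fun A => lall (fun B => lall (fun C =>
    forceV (down u (A.2.1 - 2 * B.2.1 + C.2.1) (A.2.2 - 2 * B.2.2 + C.2.2)) fun x =>
      bif memU x then memR A.1 B.1 C.1 x else true) (chl c)) (chl b)) (chl a)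

/-- Closure of the triple states under taking children in `U`. -/
def checkR (n : ℕ) : Bool :=
  forceV (decode n) (checkR' (n / 4194304 % 8) (n / 524288 % 8) (n / 65536 % 8))

/-- The states of a parent quadruple that has to be excluded or followed. -/
def checkBp (A B C D : ℕ × ℤ × ℤ) (x y : V4) : Bool :=
  bif memR A.1 B.1 C.1 x then bif memR B.1 C.1 D.1 y then
    memB A.1 B.1 C.1 D.1 x y &&
    (bif Nat.beq A.1 B.1 && Nat.beq B.1 C.1 && Nat.beq C.1 D.1 &&
        eqV x ⟨0, 0, 0, 0⟩ && eqV y ⟨0, 0, 0, 0⟩ then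
      decide (A.2 = B.2) && decide (B.2 = C.2) && decide (C.2 = D.2)
    else true)
  else true else true

def checkB' (a b c d : ℕ) (u v : V4) : Bool :=
  memU u && memU v &&
  lall (fun A => lall (fun B => lall (fun C => lall (fun D =>
    upk u (A.2.1 - 2 * B.2.1 + C.2.1) (A.2.2 - 2 * B.2.2 + C.2.2) fun x =>
    upk v (B.2.1 - 2 * C.2.1 + D.2.1) (B.2.2 - 2 * C.2.2 + D.2.2) fun y =>
      checkBp A B C D x y)
    (parl d)) (parl c)) (parl b)) (parl a)

/-- Closure of the quadruple states under taking parents. -/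
def checkB (n : ℕ) : Bool :=
  forceV (decode (n / 65536)) fun u => forceV (decode n) fun v =>
    checkB' (n / 2199023255552 % 8) (n / 274877906944 % 8) (n / 34359738368 % 8)
      (n / 4294967296 % 8) u v

/-- The alphabet. -/
def alph : List ℕ := [0, 1, 3, 4]

/-- Every pair of overlapping triple states in the kernel gives a quadruple state. -/
def checkS : Bool :=
  lall (fun a => lall (fun b => lall (fun c => lall (fun u => bif memR a b c u then
    lall (fun d => lall (fun v => bif memR b c d v then memB a b c d u v else true) kerVals) alph
    else true) kerVals) alph) alph) alph

theorem checkU_all : KT.all checkU KT.treeU = true := by decide +kernel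
theorem checkR_all : KT.all checkR KT.treeR = true := by decide +kernel
theorem checkB_all : KT.all checkB KT.treeB = true := by decide +kernel
theorem checkS_true : checkS = true := by decide +kernel


/-! ### Positions in the iterates -/

/-- Letter counts. -/
def cnt (x : List ℕ) : V4 := ⟨x.count 0, x.count 1, x.count 3, x.count 4⟩

theorem cnt_nil : cnt [] = ⟨0, 0, 0, 0⟩ := by simp [cnt]

theorem phi_append (x y : List ℕ) : phi (x ++ y) = phi x ++ phi y := by
  simp [phi]

theorem phi_cons (a : ℕ) (x : List ℕ) : phi (a :: x) = phiLetter a ++ phi x := by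
  simp [phi]

theorem letter_cases (a : ℕ) : (a = 0 ∨ a = 1 ∨ a = 3 ∨ a = 4) ∨
    (phiLetter a = [] ∧ a ≠ 0 ∧ a ≠ 1 ∧ a ≠ 3 ∧ a ≠ 4) := by
  match a with
  | 0 => simp
  | 1 => simp
  | 2 => simp [phiLetter]
  | 3 => simp
  | 4 => simp
  | (n + 5) => simp [phiLetter]

theorem cnt_phi (x : List ℕ) : cnt (phi x) = down (cnt x) 0 0 := by
  induction x with
  | nil => simp [phi, cnt, down]
  | cons a x ih =>
    rw [phi_cons]
    simp only [cnt, down, V4.mk.injEq, List.count_append, List.count_cons] at ih ⊢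
    obtain ⟨h0, h1, h3, h4⟩ := ih
    push_cast
    rcases letter_cases a with (rfl | rfl | rfl | rfl) | ⟨h, n0, n1, n3, n4⟩
    · simp [phiLetter, h0, h1, h3, h4]; omega
    · simp [phiLetter, h0, h1, h3, h4]; omega
    · simp [phiLetter, h0, h1, h3, h4]; omega
    · simp [phiLetter, h0, h1, h3, h4]; omega
    · simp [h, h0, h1, h3, h4, n0, n1, n3, n4]

/-- `l` is a letter of `φ^k(0)`, and `V` counts the letters before it. -/
def IsPos (k l : ℕ) (V : V4) : Prop :=
  ∃ x y, phi^[k] [0] = x ++ l :: y ∧ V = cnt x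

theorem isPos_zero {l : ℕ} {V : V4} (h : IsPos 0 l V) : l = 0 ∧ V = ⟨0, 0, 0, 0⟩ := by
  obtain ⟨x, y, hxy, rfl⟩ := h
  cases x with
  | nil =>
    simp at hxy
    exact ⟨hxy.1.symm, cnt_nil⟩
  | cons a x => simp at hxy

theorem phi_split (z : List ℕ) : ∀ (x y : List ℕ) (m : ℕ), phi z = x ++ m :: y →
    ∃ z1 l z2 d1 d2, z = z1 ++ l :: z2 ∧ phiLetter l = d1 ++ m :: d2 ∧ x = phi z1 ++ d1 := by
  induction z with
  | nil => intro x y m h; simp [phi] at h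
  | cons a z ih =>
    intro x y m h
    rw [phi_cons] at h
    rcases List.append_eq_append_iff.1 h with ⟨t, h1, h2⟩ | ⟨t, h1, h2⟩
    · obtain ⟨z1, l, z2, d1, d2, e1, e2, e3⟩ := ih t y m h2
      exact ⟨a :: z1, l, z2, d1, d2, by simp [e1], e2, by rw [h1, e3, phi_cons, List.append_assoc]⟩
    · cases t with
      | nil =>
        simp at h1 h2
        obtain ⟨z1, l, z2, d1, d2, e1, e2, e3⟩ := ih [] y m (by simp [h2])
        exact ⟨a :: z1, l, z2, d1, d2, by simp [e1], e2, by
          rw [phi_cons, List.append_assoc, ← e3, h1]; simp⟩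
      | cons b t =>
        simp at h2
        obtain ⟨rfl, h2⟩ := h2
        exact ⟨[], a, z, x, t, by simp, h1, by simp [phi]⟩

theorem digit_cases (l m : ℕ) (d1 d2 : List ℕ) (h : phiLetter l = d1 ++ m :: d2) :
    ∃ p q : ℤ, (m, p, q) ∈ chl l ∧ (l, p, q) ∈ parl m ∧ l ∈ alph ∧ cnt d1 = ⟨p, 0, 0, q⟩ := by
  rcases letter_cases l with (rfl | rfl | rfl | rfl) | ⟨h', -⟩
  · rcases d1 with _ | ⟨a, _ | ⟨b, d1⟩⟩ <;> simp [phiLetter] at h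
    · obtain ⟨rfl, rfl⟩ := h; exact ⟨0, 0, by simp [chl, parl, cnt, alph]⟩
    · obtain ⟨rfl, rfl, rfl⟩ := h; exact ⟨1, 0, by simp [chl, parl, cnt, alph]⟩
  · rcases d1 with _ | ⟨a, _ | ⟨b, d1⟩⟩ <;> simp [phiLetter] at h
    · obtain ⟨rfl, rfl⟩ := h; exact ⟨0, 0, by simp [chl, parl, cnt, alph]⟩
    · obtain ⟨rfl, rfl, rfl⟩ := h; exact ⟨0, 1, by simp [chl, parl, cnt, alph]⟩
  · rcases d1 with _ | ⟨a, d1⟩ <;> simp [phiLetter] at h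
    · obtain ⟨rfl, rfl⟩ := h; exact ⟨0, 0, by simp [chl, parl, cnt, alph]⟩
  · rcases d1 with _ | ⟨a, _ | ⟨b, d1⟩⟩ <;> simp [phiLetter] at h
    · obtain ⟨rfl, rfl⟩ := h; exact ⟨0, 0, by simp [chl, parl, cnt, alph]⟩
    · obtain ⟨rfl, rfl, rfl⟩ := h; exact ⟨1, 0, by simp [chl, parl, cnt, alph]⟩
  · rw [h'] at h; simp at h

theorem isPos_succ {k m : ℕ} {V : V4} (h : IsPos (k + 1) m V) :
    ∃ l V' p q, IsPos k l V' ∧ (m, p, q) ∈ chl l ∧ (l, p, q) ∈ parl m ∧ V = down V' p q := by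
  obtain ⟨x, y, hxy, rfl⟩ := h
  rw [Function.iterate_succ_apply'] at hxy
  obtain ⟨z1, l, z2, d1, d2, e1, e2, e3⟩ := phi_split _ _ _ _ hxy
  obtain ⟨p, q, h1, h2, -, h3⟩ := digit_cases l m d1 d2 e2
  refine ⟨l, cnt z1, p, q, ⟨z1, z2, e1, rfl⟩, h1, h2, ?_⟩
  have h4 := cnt_phi z1
  simp only [cnt, down, V4.mk.injEq] at h3 h4
  rw [e3]
  simp only [cnt, down, V4.mk.injEq, List.count_append]
  push_cast
  omega

theorem phi_alph (x : List ℕ) : ∀ a ∈ phi x, a ∈ alph := by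
  intro a ha
  simp only [phi, List.mem_flatMap] at ha
  obtain ⟨b, -, hb⟩ := ha
  rcases letter_cases b with (rfl | rfl | rfl | rfl) | ⟨h, -⟩
  · simp [phiLetter] at hb; simp [alph]; omega
  · simp [phiLetter] at hb; simp [alph]; omega
  · simp [phiLetter] at hb; simp [alph]; omega
  · simp [phiLetter] at hb; simp [alph]; omega
  · simp [h] at hb

theorem iter_alph (k : ℕ) : ∀ a ∈ phi^[k] [0], a ∈ alph := by
  cases k with
  | zero => simp [alph]
  | succ k =>
    rw [Function.iterate_succ_apply']
    exact phi_alph _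

theorem cnt_len (x : List ℕ) (h : ∀ a ∈ x, a ∈ alph) :
    ((x.length : ℕ) : ℤ) = (cnt x).c0 + (cnt x).c1 + (cnt x).c3 + (cnt x).c4 ∧
    ((x.sum : ℕ) : ℤ) = (cnt x).c1 + 3 * (cnt x).c3 + 4 * (cnt x).c4 := by
  induction x with
  | nil => simp [cnt]
  | cons a x ih =>
    have ih' := ih (fun b hb => h b (List.mem_cons_of_mem _ hb))
    have ha := h a List.mem_cons_self
    simp only [cnt, List.length_cons, List.sum_cons, List.count_cons] at ih' ⊢
    simp only [alph, List.mem_cons, List.not_mem_nil, or_false] at ha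
    rcases ha with rfl | rfl | rfl | rfl <;> simp [-Nat.cast_list_sum] <;> omega

theorem isPos_unique {k l l' : ℕ} {V : V4} (h : IsPos k l V) (h' : IsPos k l' V) : l = l' := by
  obtain ⟨x, y, hxy, e⟩ := h
  obtain ⟨x', y', hxy', e'⟩ := h'
  have a1 := (cnt_len x (fun b hb => iter_alph k b (by rw [hxy]; simp [hb]))).1
  have a2 := (cnt_len x' (fun b hb => iter_alph k b (by rw [hxy']; simp [hb]))).1
  rw [← e] at a1
  rw [← e'] at a2
  have hl : x.length = x'.length := by omega
  have := (List.append_inj (hxy.symm.trans hxy') hl).2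
  simp at this
  exact this.1

theorem isPos_alph {k l : ℕ} {V : V4} (h : IsPos k l V) : l ∈ alph := by
  obtain ⟨x, y, hxy, -⟩ := h
  exact iter_alph k l (by rw [hxy]; simp)

/-! ### Using the finite checks -/

theorem alph_lt {a : ℕ} (h : a ∈ alph) : a < 8 := by
  simp [alph] at h
  omega

theorem okU_of_memU {u : V4} (h : memU u = true) {p q : ℤ} (hd : (p, q) ∈ deltas) :
    okU (up u p q) = true := by
  unfold memU at h
  rw [forceN_eq] at h
  cases hb : box u
  · simp [hb] at h
  · simp only [hb, cond_true] at h
    have h1 := KT.all_of_mem _ _ _ h checkU_all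
    unfold checkU at h1
    rw [forceV_eq, lall_iff] at h1
    have h2 := h1 _ hd
    have h3 := decode_code u hb 0
    rw [upk_eq] at h2
    rw [Nat.zero_mul, Nat.zero_add] at h3
    simpa [h3] using h2

theorem memU_parent {x : V4} {p q : ℤ} (hd : (p, q) ∈ deltas) (hq : qf x ≤ 507)
    (h : memU (down x p q) = true) : memU x = true := by
  have h1 := okU_of_memU h hd
  rw [up_down] at h1
  unfold okU at h1
  cases hm : memU x
  · simp only [hm, cond_false] at h1
    have := lt_of_qbig x h1
    omega
  · rfl

theorem checkR_of_memR {a b c : ℕ} {u : V4} (ha : a ∈ alph) (hb : b ∈ alph) (hc : c ∈ alph)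
    (h : memR a b c u = true) : checkR' a b c u = true := by
  unfold memR at h
  rw [forceN_eq] at h
  cases hx : box u
  · simp [hx] at h
  · simp only [hx, cond_true] at h
    have h1 := KT.all_of_mem _ _ _ h checkR_all
    have hl := code_lt u hx
    have := alph_lt ha
    have := alph_lt hb
    have := alph_lt hc
    unfold checkR at h1
    rw [forceV_eq, decode_code u hx] at h1
    have e1 : (((a * 8 + b) * 8 + c) * 65536 + code u) / 4194304 % 8 = a := by omega
    have e2 : (((a * 8 + b) * 8 + c) * 65536 + code u) / 524288 % 8 = b := by omega
    have e3 : (((a * 8 + b) * 8 + c) * 65536 + code u) / 65536 % 8 = c := by omega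
    rwa [e1, e2, e3] at h1

theorem eqV_iff (u v : V4) : eqV u v = true ↔ u = v := by
  simp [eqV, V4.ext_iff, and_assoc]

theorem ker_iff (u : V4) : ker u = true ↔
    u.c0 + u.c1 + u.c3 + u.c4 = 0 ∧ u.c1 + 3 * u.c3 + 4 * u.c4 = 0 := by
  simp [ker]

theorem memR_ker {a b c : ℕ} {u : V4} (ha : a ∈ alph) (hb : b ∈ alph) (hc : c ∈ alph)
    (h : memR a b c u = true) (hk : ker u = true) : u ∈ kerVals := by
  have h1 := checkR_of_memR ha hb hc h
  unfold checkR' at h1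
  rw [hk, Bool.and_eq_true] at h1
  have h2 := h1.1
  simp only [cond_true, Bool.or_eq_true, eqV_iff] at h2
  simp only [kerVals, List.mem_cons, List.not_mem_nil, or_false]
  tauto

theorem memR_child {a b c a' b' c' : ℕ} {u : V4} {p p' p'' q q' q'' : ℤ}
    (ha : a ∈ alph) (hb : b ∈ alph) (hc : c ∈ alph) (h : memR a b c u = true)
    (h1 : (a', p, q) ∈ chl a) (h2 : (b', p', q') ∈ chl b) (h3 : (c', p'', q'') ∈ chl c)
    (hU : memU (down u (p - 2 * p' + p'') (q - 2 * q' + q'')) = true) :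
    memR a' b' c' (down u (p - 2 * p' + p'') (q - 2 * q' + q'')) = true := by
  have h4 := checkR_of_memR ha hb hc h
  unfold checkR' at h4
  rw [Bool.and_eq_true] at h4
  have h5 := h4.2
  rw [lall_iff] at h5
  have h6 := h5 _ h1
  rw [lall_iff] at h6
  have h7 := h6 _ h2
  rw [lall_iff] at h7
  have h8 := h7 _ h3
  rw [forceV_eq] at h8
  simp only [hU, cond_true] at h8
  exact h8

theorem checkB_of_memB {a b c d : ℕ} {u v : V4} (ha : a ∈ alph) (hb : b ∈ alph) (hc : c ∈ alph)
    (hd : d ∈ alph) (h : memB a b c d u v = true) : checkB' a b c d u v = true := by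
  unfold memB at h
  rw [forceN_eq] at h
  cases hx : box u
  · simp [hx] at h
  cases hy : box v
  · simp [hx, hy] at h
  simp only [hx, hy, cond_true] at h
  have h1 := KT.all_of_mem _ _ _ h checkB_all
  have hl := code_lt u hx
  have hl' := code_lt v hy
  have := alph_lt ha
  have := alph_lt hb
  have := alph_lt hc
  have := alph_lt hd
  unfold checkB at h1
  rw [forceV_eq, forceV_eq, decode_code v hy] at h1
  generalize hn : ((((a * 8 + b) * 8 + c) * 8 + d) * 65536 + code u) * 65536 + code v = n at h1
  have e0 : n / 65536 = (((a * 8 + b) * 8 + c) * 8 + d) * 65536 + code u := by omega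
  have e1 : n / 2199023255552 % 8 = a := by omega
  have e2 : n / 274877906944 % 8 = b := by omega
  have e3 : n / 34359738368 % 8 = c := by omega
  have e4 : n / 4294967296 % 8 = d := by omega
  rwa [e1, e2, e3, e4, e0, decode_code u hx] at h1

theorem memB_memU {a b c d : ℕ} {u v : V4} (ha : a ∈ alph) (hb : b ∈ alph) (hc : c ∈ alph)
    (hd : d ∈ alph) (h : memB a b c d u v = true) : memU u = true ∧ memU v = true := by
  have h1 := checkB_of_memB ha hb hc hd h
  unfold checkB' at h1
  rw [Bool.and_eq_true, Bool.and_eq_true] at h1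
  exact h1.1

theorem memB_parent {a b c d : ℕ} {x y : V4} {A B C D : ℕ × ℤ × ℤ}
    (ha : a ∈ alph) (hb : b ∈ alph) (hc : c ∈ alph) (hd : d ∈ alph)
    (h : memB a b c d (down x (A.2.1 - 2 * B.2.1 + C.2.1) (A.2.2 - 2 * B.2.2 + C.2.2))
      (down y (B.2.1 - 2 * C.2.1 + D.2.1) (B.2.2 - 2 * C.2.2 + D.2.2)) = true)
    (hA : A ∈ parl a) (hB : B ∈ parl b) (hC : C ∈ parl c) (hD : D ∈ parl d)
    (hx : memR A.1 B.1 C.1 x = true) (hy : memR B.1 C.1 D.1 y = true) :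
    memB A.1 B.1 C.1 D.1 x y = true ∧
    (A.1 = B.1 → B.1 = C.1 → C.1 = D.1 → x = ⟨0, 0, 0, 0⟩ → y = ⟨0, 0, 0, 0⟩ →
      A.2 = B.2 ∧ B.2 = C.2 ∧ C.2 = D.2) := by
  have h1 := checkB_of_memB ha hb hc hd h
  unfold checkB' at h1
  rw [Bool.and_eq_true] at h1
  have h2 := h1.2
  rw [lall_iff] at h2
  have h3 := h2 _ hA
  rw [lall_iff] at h3
  have h4 := h3 _ hB
  rw [lall_iff] at h4
  have h5 := h4 _ hC
  rw [lall_iff] at h5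
  have h6 := h5 _ hD
  rw [upk_eq, upk_eq, up_down, up_down] at h6
  unfold checkBp at h6
  simp only [hx, hy, cond_true] at h6
  rw [Bool.and_eq_true] at h6
  refine ⟨h6.1, ?_⟩
  intro k1 k2 k3 k4 k5
  have h7 := h6.2
  have z : (Nat.beq A.1 B.1 && Nat.beq B.1 C.1 && Nat.beq C.1 D.1 &&
        eqV x ⟨0, 0, 0, 0⟩ && eqV y ⟨0, 0, 0, 0⟩) = true := by
    simp only [Bool.and_eq_true, Nat.beq_eq, eqV_iff]
    exact ⟨⟨⟨⟨k1, k2⟩, k3⟩, k4⟩, k5⟩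
  rw [z] at h7
  simp only [cond_true, Bool.and_eq_true, decide_eq_true_eq] at h7
  tauto

theorem memB_start {a b c d : ℕ} {u v : V4} (ha : a ∈ alph) (hb : b ∈ alph) (hc : c ∈ alph)
    (hd : d ∈ alph) (hx : memR a b c u = true) (hy : memR b c d v = true)
    (hu : ker u = true) (hv : ker v = true) : memB a b c d u v = true := by
  have ku := memR_ker ha hb hc hx hu
  have kv := memR_ker hb hc hd hy hv
  have h := checkS_true
  unfold checkS at h
  rw [lall_iff] at h
  have h := h _ ha
  rw [lall_iff] at h
  have h := h _ hb
  rw [lall_iff] at h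
  have h := h _ hc
  rw [lall_iff] at h
  have h := h _ ku
  simp only [hx, cond_true] at h
  rw [lall_iff] at h
  have h := h _ hd
  rw [lall_iff] at h
  have h := h _ kv
  simp only [hy, cond_true] at h
  exact h

/-! ### The quadratic bound -/

theorem qf_identity (x0 x1 x3 x4 p q : ℚ) :
    5 * (x0 * (15 * x0 - 22 * x1 - 22 * x3 + 10 * x4) + x1 * (8 * x3 - 8 * x4 - x1)
      + x3 * (8 * x3 - 28 * x4) + 8 * (x4 * x4))
    - 8 * ((x0 + x4 + p) * (15 * (x0 + x4 + p) - 22 * (x3 + x4) - 22 * (x0 + x1) + 10 * (x1 + q))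
      + (x3 + x4) * (8 * (x0 + x1) - 8 * (x1 + q) - (x3 + x4))
      + (x0 + x1) * (8 * (x0 + x1) - 28 * (x1 + q)) + 8 * ((x1 + q) * (x1 + q))) =
    1 / 67 * (67 * x0 + 41 * x1 + x3 + 49 * x4 - 32 * p + 72 * q) ^ 2
    + 1 / 295872 * (4416 * x1 + 1299 * x3 - 133 * x4 + 4528 * p + 264 * q) ^ 2
    + 1 / 91615808 * (62239 * x3 + 38055 * x4 + 100976 * p + 43816 * q) ^ 2
    + 4 / 455812980249 * (2441197 * x4 - 2264158 * p - 3675438 * q) ^ 2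
    - (880928360 * p ^ 2 + 639460400 * (p * q) + 686248080 * q ^ 2) / 2441197 := by
  ring

theorem qf_down {x : V4} {p q : ℤ} (hd : (p, q) ∈ deltas) (h : qf x ≤ 507) :
    qf (down x p q) ≤ 507 := by
  have hr : (880928360 * (p : ℚ) ^ 2 + 639460400 * (p * q) + 686248080 * (q : ℚ) ^ 2) / 2441197
      ≤ 1521 := by
    simp only [deltas, List.mem_cons, Prod.mk.injEq, List.not_mem_nil, or_false] at hd
    rcases hd with h | h | h | h | h | h | h | h | h | h | h | h | h | h | h | h <;>
      (obtain ⟨rfl, rfl⟩ := h; norm_num [Int.negSucc_eq])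
  have hi := qf_identity x.c0 x.c1 x.c3 x.c4 p q
  have h' : ((qf x : ℤ) : ℚ) ≤ 507 := by exact_mod_cast h
  have goal : ((qf (down x p q) : ℤ) : ℚ) ≤ 507 := by
    simp only [qf, down] at h' ⊢
    push_cast at h' ⊢
    have s1 := sq_nonneg (67 * (x.c0 : ℚ) + 41 * x.c1 + x.c3 + 49 * x.c4 - 32 * p + 72 * q)
    have s2 := sq_nonneg (4416 * (x.c1 : ℚ) + 1299 * x.c3 - 133 * x.c4 + 4528 * p + 264 * q)
    have s3 := sq_nonneg (62239 * (x.c3 : ℚ) + 38055 * x.c4 + 100976 * p + 43816 * q)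
    have s4 := sq_nonneg (2441197 * (x.c4 : ℚ) - 2264158 * p - 3675438 * q)
    linarith
  exact_mod_cast goal

/-- Vectors in the kernel of length and sum. -/
def kvec (c d : ℤ) : V4 := ⟨2 * c + 3 * d, -3 * c - 4 * d, c, d⟩

theorem kvec_check : ∀ c ∈ Finset.Icc (-6 : ℤ) 6, ∀ d ∈ Finset.Icc (-3 : ℤ) 3,
    qf (kvec c d) ≤ 507 → memU (kvec c d) = true := by
  decide +kernel

theorem memU_ker {u : V4} (hk : ker u = true) (hq : qf u ≤ 507) : memU u = true := by
  rw [ker_iff] at hk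
  obtain ⟨h1, h2⟩ := hk
  have e : u = kvec u.c3 u.c4 := by
    ext <;> simp only [kvec] <;> omega
  have hq' : 123 * (u.c3 * u.c3) + 448 * (u.c3 * u.c4) + 453 * (u.c4 * u.c4) ≤ 507 := by
    rw [e] at hq
    simp only [qf, kvec] at hq
    linarith
  rw [e]
  refine kvec_check _ ?_ _ ?_ (by rw [← e]; exact hq)
  · rw [Finset.mem_Icc]
    constructor <;> nlinarith [sq_nonneg (453 * u.c4 + 224 * u.c3)]
  · rw [Finset.mem_Icc]
    constructor <;> nlinarith [sq_nonneg (123 * u.c3 + 224 * u.c4)]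

/-! ### The descent -/

/-- Second differences. -/
def sd (A B C : V4) : V4 :=
  ⟨A.c0 - 2 * B.c0 + C.c0, A.c1 - 2 * B.c1 + C.c1, A.c3 - 2 * B.c3 + C.c3,
    A.c4 - 2 * B.c4 + C.c4⟩

theorem sd_down (A B C : V4) (p p' p'' q q' q'' : ℤ) :
    sd (down A p q) (down B p' q') (down C p'' q'') =
      down (sd A B C) (p - 2 * p' + p'') (q - 2 * q' + q'') := by
  ext <;> simp only [sd, down] <;> ring

theorem sd_self (A : V4) : sd A A A = ⟨0, 0, 0, 0⟩ := by
  ext <;> simp only [sd] <;> ring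

theorem chl_digit {m l : ℕ} {p q : ℤ} (h : (m, p, q) ∈ chl l) :
    (p = 0 ∧ q = 0) ∨ (p = 1 ∧ q = 0) ∨ (p = 0 ∧ q = 1) := by
  unfold chl at h
  split at h <;> simp at h <;> omega

theorem mem_deltas {a b c a' b' c' : ℕ} {p p' p'' q q' q'' : ℤ}
    (h1 : (a', p, q) ∈ chl a) (h2 : (b', p', q') ∈ chl b) (h3 : (c', p'', q'') ∈ chl c) :
    (p - 2 * p' + p'', q - 2 * q' + q'') ∈ deltas := by
  rcases chl_digit h1 with ⟨rfl, rfl⟩ | ⟨rfl, rfl⟩ | ⟨rfl, rfl⟩ <;>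
  rcases chl_digit h2 with ⟨rfl, rfl⟩ | ⟨rfl, rfl⟩ | ⟨rfl, rfl⟩ <;>
  rcases chl_digit h3 with ⟨rfl, rfl⟩ | ⟨rfl, rfl⟩ | ⟨rfl, rfl⟩ <;> decide

theorem qf_bound (k : ℕ) : ∀ {a b c : ℕ} {A B C : V4}, IsPos k a A → IsPos k b B → IsPos k c C →
    qf (sd A B C) ≤ 507 := by
  induction k with
  | zero =>
    intro a b c A B C ha hb hc
    rw [(isPos_zero ha).2, (isPos_zero hb).2, (isPos_zero hc).2]
    decide
  | succ k ih =>
    intro a b c A B C ha hb hc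
    obtain ⟨a', A', p, q, hA, ca, -, rfl⟩ := isPos_succ ha
    obtain ⟨b', B', p', q', hB, cb, -, rfl⟩ := isPos_succ hb
    obtain ⟨c', C', p'', q'', hC, cc, -, rfl⟩ := isPos_succ hc
    rw [sd_down]
    exact qf_down (mem_deltas ca cb cc) (ih hA hB hC)

theorem memR_zero : memR 0 0 0 ⟨0, 0, 0, 0⟩ = true := by decide +kernel

theorem memR_of_memU (k : ℕ) : ∀ {a b c : ℕ} {A B C : V4}, IsPos k a A → IsPos k b B →
    IsPos k c C → memU (sd A B C) = true → memR a b c (sd A B C) = true := by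
  induction k with
  | zero =>
    intro a b c A B C ha hb hc _
    rw [(isPos_zero ha).2, (isPos_zero hb).2, (isPos_zero hc).2, (isPos_zero ha).1,
      (isPos_zero hb).1, (isPos_zero hc).1, sd_self]
    exact memR_zero
  | succ k ih =>
    intro a b c A B C ha hb hc hU
    obtain ⟨a', A', p, q, hA, ca, -, rfl⟩ := isPos_succ ha
    obtain ⟨b', B', p', q', hB, cb, -, rfl⟩ := isPos_succ hb
    obtain ⟨c', C', p'', q'', hC, cc, -, rfl⟩ := isPos_succ hc
    rw [sd_down] at hU ⊢
    have hU' := memU_parent (mem_deltas ca cb cc) (qf_bound k hA hB hC) hU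
    exact memR_child (isPos_alph hA) (isPos_alph hB) (isPos_alph hC) (ih hA hB hC hU') ca cb cc hU

theorem eq_of_memB (k : ℕ) : ∀ {a b c d : ℕ} {A B C D : V4}, IsPos k a A → IsPos k b B →
    IsPos k c C → IsPos k d D → memB a b c d (sd A B C) (sd B C D) = true →
    A = B ∧ B = C ∧ C = D := by
  induction k with
  | zero =>
    intro a b c d A B C D ha hb hc hd _
    rw [(isPos_zero ha).2, (isPos_zero hb).2, (isPos_zero hc).2, (isPos_zero hd).2]
    simp
  | succ k ih =>
    intro a b c d A B C D ha hb hc hd h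
    have la := isPos_alph ha
    have lb := isPos_alph hb
    have lc := isPos_alph hc
    have ld := isPos_alph hd
    obtain ⟨a', A', p, q, hA, ca, pa, rfl⟩ := isPos_succ ha
    obtain ⟨b', B', p', q', hB, cb, pb, rfl⟩ := isPos_succ hb
    obtain ⟨c', C', p'', q'', hC, cc, pc, rfl⟩ := isPos_succ hc
    obtain ⟨d', D', p3, q3, hD, cd, pd, rfl⟩ := isPos_succ hd
    rw [sd_down, sd_down] at h
    obtain ⟨hU, hV⟩ := memB_memU la lb lc ld h
    have hU' := memU_parent (mem_deltas ca cb cc) (qf_bound k hA hB hC) hU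
    have hV' := memU_parent (mem_deltas cb cc cd) (qf_bound k hB hC hD) hV
    have hR := memR_of_memU k hA hB hC hU'
    have hR' := memR_of_memU k hB hC hD hV'
    obtain ⟨m1, m2⟩ := memB_parent (A := (a', p, q)) (B := (b', p', q')) (C := (c', p'', q''))
      (D := (d', p3, q3)) la lb lc ld h pa pb pc pd hR hR'
    obtain ⟨rfl, rfl, rfl⟩ := ih hA hB hC hD m1
    obtain rfl := isPos_unique hA hB
    obtain rfl := isPos_unique hA hC
    obtain rfl := isPos_unique hA hD
    obtain ⟨e1, e2, e3⟩ := m2 rfl rfl rfl (sd_self _) (sd_self _)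
    simp only [Prod.mk.injEq] at e1 e2 e3
    obtain ⟨rfl, rfl⟩ := e1
    obtain ⟨rfl, rfl⟩ := e2
    obtain ⟨rfl, rfl⟩ := e3
    exact ⟨rfl, rfl, rfl⟩

/-! ### Relation with the infinite word -/

theorem iter_append (k : ℕ) (x y : List ℕ) : phi^[k] (x ++ y) = phi^[k] x ++ phi^[k] y := by
  induction k generalizing x y with
  | zero => rfl
  | succ k ih => rw [Function.iterate_succ_apply, phi_append, ih]; rfl

theorem phi_ne_nil {x : List ℕ} (hx : x ≠ []) (h : ∀ a ∈ x, a ∈ alph) : phi x ≠ [] := by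
  cases x with
  | nil => exact absurd rfl hx
  | cons a x =>
    have ha := h a List.mem_cons_self
    rw [phi_cons]
    simp only [alph, List.mem_cons, List.not_mem_nil, or_false] at ha
    rcases ha with rfl | rfl | rfl | rfl <;> simp [phiLetter]

theorem iter_three (k : ℕ) : phi^[k] [3] ≠ [] ∧ ∀ a ∈ phi^[k] [3], a ∈ alph := by
  induction k with
  | zero => simp [alph]
  | succ k ih =>
    rw [Function.iterate_succ_apply']
    exact ⟨phi_ne_nil ih.1 ih.2, phi_alph _⟩

theorem iter_succ (k : ℕ) : phi^[k + 1] [0] = phi^[k] [0] ++ phi^[k] [3] := by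
  rw [Function.iterate_succ_apply, ← iter_append]
  rfl

theorem iter_length (k : ℕ) : k + 1 ≤ (phi^[k] [0]).length := by
  induction k with
  | zero => simp
  | succ k ih =>
    rw [iter_succ, List.length_append]
    have := List.length_pos_of_ne_nil (iter_three k).1
    omega

theorem w_eq (n j : ℕ) : w n = (phi^[n + 1 + j] [0]).getD n 0 := by
  induction j with
  | zero => rfl
  | succ j ih =>
    rw [ih, ← add_assoc, iter_succ]
    have := iter_length (n + 1 + j)
    rw [List.getD_append _ _ _ _ (by omega)]

theorem w_eq' {n K : ℕ} (h : n < K) : w n = (phi^[K] [0]).getD n 0 := by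
  obtain ⟨j, rfl⟩ := Nat.exists_eq_add_of_le (Nat.succ_le_of_lt h)
  exact w_eq n j

theorem take_sum (K p : ℕ) (h : p ≤ K) :
    ((phi^[K] [0]).take p).sum = ∑ j ∈ Finset.range p, w j := by
  induction p with
  | zero => simp
  | succ p ih =>
    have hl := iter_length K
    have hp : p < (phi^[K] [0]).length := by omega
    rw [Finset.sum_range_succ, ← ih (by omega), List.take_succ_eq_append_getElem hp,
      List.sum_append, w_eq' (n := p) (K := K) (by omega)]
    rw [List.getD_eq_getElem _ _ hp]
    simp

theorem exists_pos (K p : ℕ) (h : p < K) : ∃ l V, IsPos K l V ∧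
    (p : ℤ) = V.c0 + V.c1 + V.c3 + V.c4 ∧
    ((∑ j ∈ Finset.range p, w j : ℕ) : ℤ) = V.c1 + 3 * V.c3 + 4 * V.c4 := by
  have hl := iter_length K
  have hp : p < (phi^[K] [0]).length := by omega
  have hc := cnt_len ((phi^[K] [0]).take p) (fun a ha => iter_alph K a (List.mem_of_mem_take ha))
  refine ⟨(phi^[K] [0])[p], cnt ((phi^[K] [0]).take p),
    ⟨_, (phi^[K] [0]).drop (p + 1), ?_, rfl⟩, ?_, ?_⟩
  · rw [← List.drop_eq_getElem_cons hp, List.take_append_drop]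
  · rw [← hc.1, List.length_take]
    congr 1
    omega
  · rw [← hc.2, take_sum K p (by omega)]

theorem sum_block (i n : ℕ) : ∑ j ∈ Finset.range (i + n), w j =
    ∑ j ∈ Finset.range i, w j + ∑ j ∈ Finset.range n, w (i + j) :=
  Finset.sum_range_add _ _ _

theorem main (i n : ℕ) (hn : 1 ≤ n)
    (h1 : ∑ j ∈ Finset.range n, w (i + j) = ∑ j ∈ Finset.range n, w (i + n + j))
    (h2 : ∑ j ∈ Finset.range n, w (i + n + j) = ∑ j ∈ Finset.range n, w (i + 2 * n + j)) :
    False := by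
  obtain ⟨a, A, hA, nA, sA⟩ := exists_pos (i + 3 * n + 1) i (by omega)
  obtain ⟨b, B, hB, nB, sB⟩ := exists_pos (i + 3 * n + 1) (i + n) (by omega)
  obtain ⟨c, C, hC, nC, sC⟩ := exists_pos (i + 3 * n + 1) (i + 2 * n) (by omega)
  obtain ⟨d, D, hD, nD, sD⟩ := exists_pos (i + 3 * n + 1) (i + 3 * n) (by omega)
  have b1 := sum_block i n
  have b2 := sum_block (i + n) n
  have b3 := sum_block (i + 2 * n) n
  rw [show i + n + n = i + 2 * n by ring] at b2
  rw [show i + 2 * n + n = i + 3 * n by ring] at b3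
  have hk : ker (sd A B C) = true := by
    rw [ker_iff]
    simp only [sd]
    constructor <;> omega
  have hk' : ker (sd B C D) = true := by
    rw [ker_iff]
    simp only [sd]
    constructor <;> omega
  have r1 := memR_of_memU _ hA hB hC (memU_ker hk (qf_bound _ hA hB hC))
  have r2 := memR_of_memU _ hB hC hD (memU_ker hk' (qf_bound _ hB hC hD))
  have hM := memB_start (isPos_alph hA) (isPos_alph hB) (isPos_alph hC) (isPos_alph hD) r1 r2 hk hk'
  obtain ⟨rfl, -, -⟩ := eq_of_memB _ hA hB hC hD hM
  omega


end

end AddCube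

/-- The infinite word `w` contains no additive cube. -/
theorem w_avoids_additive_cubes :
    ∀ (i n : ℕ), 1 ≤ n →
      ¬ ((∑ j ∈ Finset.range n, w (i + j) = ∑ j ∈ Finset.range n, w (i + n + j)) ∧
         (∑ j ∈ Finset.range n, w (i + n + j) = ∑ j ∈ Finset.range n, w (i + 2 * n + j))) := by
  intro i n hn h
  exact AddCube.main i n hn h.1 h.2
end

section
/- There exists a two-sided infinite word over the alphabet {0,1,3,4} avoiding additive cubes: there is a function f : ℤ → ℕ with f(k) ∈ {0,1,3,4} for all k ∈ ℤ, such that for all i ∈ ℤ and all n ≥ 1, it is NOT the case that ∑_{j<n} f(i+j) = ∑_{j<n} f(i+n+j) and ∑_{j<n} f(i+n+j) = ∑_{j<n} f(i+2n+j). -/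
namespace AddCube

/-- The four letters `0, 1, 3, 4`. -/
inductive Lt where
  | a | b | c | d
  deriving DecidableEq

/-- Integer vectors indexed by the four letters. -/
structure V4_s2 where
  a : ℤ
  b : ℤ
  c : ℤ
  d : ℤ

/-- Centres (real part) of the discs, scaled by `10^4`. -/
def cx : Lt → ℤ
  | .a => -969
  | .b => 5900
  | .c => 7757
  | .d => 1108

/-- Centres (imaginary part) of the discs, scaled by `10^4`. -/
def cy : Lt → ℤ
  | .a => 1063
  | .b => 2719
  | .c => -2995
  | .d => 3919

/-- Radii of the discs, scaled by `10^4`. -/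
def rad : Lt → ℤ
  | .a => 2967
  | .b => 4563
  | .c => 5129
  | .d => 2874

/-- Approximate disc test. -/
def disc (D : V4_s2) (x y r : ℤ) : Bool :=
  let zr := 10000 * D.a - 4685 * D.b - 5926 * D.c + 4438 * D.d - x
  let zi := -883 * D.b + 4766 * D.c - 7358 * D.d - y
  let s := r + (D.a.natAbs + D.b.natAbs + D.c.natAbs + D.d.natAbs : ℕ)
  decide (zr * zr + zi * zi ≤ s * s)

def ok1 (l0 l1 l2 : Lt) (D : V4_s2) : Bool :=
  disc D (cx l2 - 2 * cx l1 + cx l0) (cy l2 - 2 * cy l1 + cy l0) (rad l2 + 2 * rad l1 + rad l0)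

def ok2 (l0 l1 l2 l3 : Lt) (D : V4_s2) : Bool :=
  disc D (cx l3 - cx l2 - cx l1 + cx l0) (cy l3 - cy l2 - cy l1 + cy l0)
    (rad l3 + rad l2 + rad l1 + rad l0)

/-- A desubstitution of one letter: parent letter, and the prefix of its image
(`ea` letters `0`, `ed` letters `4`). -/
structure Par where
  l : Lt
  ea : ℤ
  ed : ℤ
  deriving DecidableEq

def Q : Lt → List Par
  | .a => [⟨.a, 0, 0⟩, ⟨.d, 0, 0⟩]
  | .b => [⟨.c, 0, 0⟩, ⟨.d, 1, 0⟩]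
  | .c => [⟨.a, 1, 0⟩, ⟨.b, 0, 1⟩]
  | .d => [⟨.b, 0, 0⟩]

def nxt (D : V4_s2) (ea ed : ℤ) : V4_s2 :=
  ⟨D.c - (D.d - ed), D.d - ed, D.b - ((D.a - ea) - (D.c - (D.d - ed))),
    (D.a - ea) - (D.c - (D.d - ed))⟩

def nxt3 (D : V4_s2) (p q r : Par) : V4_s2 :=
  nxt D (r.ea - 2 * q.ea + p.ea) (r.ed - 2 * q.ed + p.ed)

def isZ (D : V4_s2) : Bool :=
  decide (D.a = 0) && decide (D.b = 0) && decide (D.c = 0) && decide (D.d = 0)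

def V4_s2.add (D E : V4_s2) : V4_s2 := ⟨D.a + E.a, D.b + E.b, D.c + E.c, D.d + E.d⟩

/-- The flag `f` (positions 0 and 1 coincide) may come from the second flag. -/
def allow : Bool → Bool → Par → Par → Bool
  | true, true, p, q => decide (p = q)
  | true, false, _, _ => false
  | false, false, _, _ => true
  | false, true, p, q => decide (p.l = q.l) && decide (p.ea + p.ed < q.ea + q.ed)

def safe : ℕ → Bool → Lt → Lt → Lt → Lt → V4_s2 → V4_s2 → Bool
  | 0, _, _, _, _, _, _, _ => false
  | n + 1, f, l0, l1, l2, l3, D1, D2 =>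
    !ok1 l0 l1 l2 D1 || (!ok1 l1 l2 l3 D2 || (!ok2 l0 l1 l2 l3 (D1.add D2) ||
    ((!f && (isZ D1 && isZ D2)) ||
    (Q l0).all fun p0 => (Q l1).all fun p1 => (Q l2).all fun p2 =>
      !ok1 p0.l p1.l p2.l (nxt3 D1 p0 p1 p2) ||
      (Q l3).all fun p3 => [true, false].all fun f' =>
        !allow f f' p0 p1 ||
          safe n f' p0.l p1.l p2.l p3.l (nxt3 D1 p0 p1 p2) (nxt3 D2 p1 p2 p3))))

def lts : List Lt := [.a, .b, .c, .d]

def zero : V4_s2 := ⟨0, 0, 0, 0⟩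

def par1 (n : ℕ) (l0 l1 l2 l3 : Lt) : Bool :=
    (Q l0).all fun p0 => (Q l1).all fun p1 => (Q l2).all fun p2 =>
      (Q l3).all fun p3 => [true, false].all fun f' =>
        !allow false f' p0 p1 ||
          safe n f' p0.l p1.l p2.l p3.l (nxt3 zero p0 p1 p2) (nxt3 zero p1 p2 p3)

theorem zero_closed : (lts.all fun l0 => lts.all fun l1 => lts.all fun l2 => lts.all fun l3 =>
    par1 20 l0 l1 l2 l3) = true := by
  decide +kernel

/-- Vectors in the kernel of length and sum. -/
def kv (x y : ℤ) : V4_s2 := ⟨2 * x + 3 * y, -3 * x - 4 * y, x, y⟩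

/-- The short list of candidates. -/
def short : List (ℤ × ℤ) := [(0, 0), (-1, 1), (1, -1), (-2, 1), (2, -1), (1, 0), (-1, 0)]

def xs : List ℤ := [-6, -5, -4, -3, -2, -1, 0, 1, 2, 3, 4, 5, 6]
def ys : List ℤ := [-4, -3, -2, -1, 0, 1, 2, 3, 4]

def inShort (x y : ℤ) : Bool := short.any fun p => decide (p.1 = x) && decide (p.2 = y)

theorem short_of_ok : (xs.all fun x => ys.all fun y => inShort x y ||
    lts.all fun l0 => lts.all fun l1 => lts.all fun l2 => !ok1 l0 l1 l2 (kv x y)) = true := by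
  decide +kernel

theorem targets : (short.all fun D1 => short.all fun D2 =>
    lts.all fun l0 => lts.all fun l1 => lts.all fun l2 => lts.all fun l3 =>
    safe 20 false l0 l1 l2 l3 (kv D1.1 D1.2) (kv D2.1 D2.2)) = true := by
  decide +kernel

/-! ### The substitution -/

/-- The substitution `0 → 03`, `1 → 43`, `3 → 1`, `4 → 01`. -/
def ph : Lt → List Lt
  | .a => [.a, .c]
  | .b => [.d, .c]
  | .c => [.b]
  | .d => [.a, .b]

/-- Iterates of the substitution on `0`. -/
def W : ℕ → List Lt
  | 0 => [.a]
  | k + 1 => (W k).flatMap ph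

/-- Parikh vector. -/
def psi (u : List Lt) : V4_s2 := ⟨u.count .a, u.count .b, u.count .c, u.count .d⟩

/-- `M D + (ea, 0, 0, ed)`. -/
def mul (D : V4_s2) (ea ed : ℤ) : V4_s2 :=
  ⟨D.a + D.d + ea, D.c + D.d, D.a + D.b, D.b + ed⟩

/-- Second difference. -/
def dd (x y z : V4_s2) : V4_s2 :=
  ⟨z.a - 2 * y.a + x.a, z.b - 2 * y.b + x.b, z.c - 2 * y.c + x.c, z.d - 2 * y.d + x.d⟩

theorem psi_flatMap (u : List Lt) : psi (u.flatMap ph) = mul (psi u) 0 0 := by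
  induction u with
  | nil => simp [psi, mul]
  | cons x u ih =>
    simp only [psi, mul, V4_s2.mk.injEq, List.flatMap_cons, List.count_append, List.count_cons] at ih ⊢
    obtain ⟨h1, h2, h3, h4⟩ := ih
    cases x <;> simp [ph] <;> omega

/-- Desubstitution data of a position. -/
theorem desub (w : List Lt) : ∀ (u : List Lt) (l : Lt), u ++ [l] <+: w.flatMap ph →
    ∃ (u' : List Lt) (m : Lt) (pre : List Lt), u' ++ [m] <+: w ∧ u = u'.flatMap ph ++ pre ∧
      pre ++ [l] <+: ph m := by
  induction w with
  | nil => intro u l h; simp at h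
  | cons x w ih =>
    intro u l h
    rw [List.flatMap_cons] at h
    by_cases hlt : u.length < (ph x).length
    · refine ⟨[], x, u, by simp, by simp, ?_⟩
      exact List.prefix_of_prefix_length_le h (List.prefix_append _ _) (by simpa using hlt)
    · have h1 : ph x <+: u := by
        apply List.prefix_of_prefix_length_le (List.prefix_append _ (w.flatMap ph))
          ((List.prefix_append u [l]).trans h)
        omega
      obtain ⟨u2, rfl⟩ := h1
      rw [List.append_assoc, List.prefix_append_right_inj] at h
      obtain ⟨u', m, pre, h1, h2, h3⟩ := ih u2 l h
      refine ⟨x :: u', m, pre, ?_, ?_, h3⟩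
      · simpa using h1
      · simp [h2]

/-- The admissible local data, as an element of `Q`. -/
theorem pre_cases (pre : List Lt) (l m : Lt) (h : pre ++ [l] <+: ph m) :
    ∃ p ∈ Q l, p.l = m ∧ p.ea + p.ed = pre.length ∧
      p.ea = pre.count .a ∧ p.ed = pre.count .d ∧ pre.count .b = 0 ∧ pre.count .c = 0 := by
  rcases pre with _ | ⟨x, _ | ⟨y, pre⟩⟩
  · cases m <;> cases l <;> simp [ph, Q] at h ⊢
  · cases m <;> cases l <;> cases x <;> simp [ph, Q] at h ⊢
  · have := h.length_le
    cases m <;> simp [ph] at this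

theorem desub1 (k : ℕ) (u : List Lt) (l : Lt) (h : u ++ [l] <+: W (k + 1)) :
    ∃ (u' pre : List Lt) (p : Par), p ∈ Q l ∧ u' ++ [p.l] <+: W k ∧ u = u'.flatMap ph ++ pre ∧
      p.ea + p.ed = pre.length ∧ pre ++ [l] <+: ph p.l ∧ psi u = mul (psi u') p.ea p.ed := by
  obtain ⟨u', m, pre, h1, h2, h3⟩ := desub (W k) u l h
  obtain ⟨p, hp, hm, hl, ha, hd, hb, hc⟩ := pre_cases pre l m h3
  subst hm
  refine ⟨u', pre, p, hp, h1, h2, hl, h3, ?_⟩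
  have h4 := psi_flatMap u'
  rw [h2]
  simp only [psi, mul, V4_s2.mk.injEq, List.count_append] at h4 ⊢
  omega

/-- The realized states at level `k`. -/
def Real (k : ℕ) (f : Bool) (l0 l1 l2 l3 : Lt) (D1 D2 : V4_s2) : Prop :=
  ∃ u0 u1 u2 u3 : List Lt, u0 ++ [l0] <+: W k ∧ u1 ++ [l1] <+: W k ∧ u2 ++ [l2] <+: W k ∧
    u3 ++ [l3] <+: W k ∧ D1 = dd (psi u0) (psi u1) (psi u2) ∧ D2 = dd (psi u1) (psi u2) (psi u3) ∧
    (f = true → u0 = u1) ∧ (f = false → u0.length < u1.length)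

theorem nxt3_dd (x y z : V4_s2) (p q r : Par) :
    nxt3 (dd (mul x p.ea p.ed) (mul y q.ea q.ed) (mul z r.ea r.ed)) p q r = dd x y z := by
  simp only [nxt3, nxt, dd, mul, V4_s2.mk.injEq]
  omega

theorem prefix_unique {w u v : List Lt} {l m : Lt} (hu : u ++ [l] <+: w) (hv : v ++ [m] <+: w)
    (h : u.length = v.length) : u = v ∧ l = m := by
  have h1 := List.prefix_of_prefix_length_le hu hv (by simp [h])
  have h2 := h1.eq_of_length (by simp [h])
  have := List.append_inj h2 h
  simpa using this

theorem step (k : ℕ) (f : Bool) (l0 l1 l2 l3 : Lt) (D1 D2 : V4_s2)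
    (h : Real (k + 1) f l0 l1 l2 l3 D1 D2) :
    ∃ p0 ∈ Q l0, ∃ p1 ∈ Q l1, ∃ p2 ∈ Q l2, ∃ p3 ∈ Q l3, ∃ f' : Bool,
      allow f f' p0 p1 = true ∧
      Real k f' p0.l p1.l p2.l p3.l (nxt3 D1 p0 p1 p2) (nxt3 D2 p1 p2 p3) := by
  obtain ⟨u0, u1, u2, u3, h0, h1, h2, h3, rfl, rfl, hf, hf'⟩ := h
  obtain ⟨v2, e2, p2, hp2, hv2, -, -, -, hs2⟩ := desub1 k u2 l2 h2
  obtain ⟨v3, e3, p3, hp3, hv3, -, -, -, hs3⟩ := desub1 k u3 l3 h3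
  obtain ⟨v0, e0, p0, hp0, hv0, he0, hl0, ht0, hs0⟩ := desub1 k u0 l0 h0
  cases f with
  | true =>
    have hu := hf rfl
    subst hu
    obtain ⟨-, rfl⟩ := prefix_unique h0 h1 rfl
    refine ⟨p0, hp0, p0, hp0, p2, hp2, p3, hp3, true, by simp [allow], v0, v0, v2, v3, hv0, hv0,
      hv2, hv3, ?_, ?_, by simp, by simp⟩
    · rw [hs0, hs2, nxt3_dd]
    · rw [hs0, hs2, hs3, nxt3_dd]
  | false =>
    have hlt := hf' rfl
    obtain ⟨v1, e1, p1, hp1, hv1, he1, hl1, ht1, hs1⟩ := desub1 k u1 l1 h1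
    have key : v0.length < v1.length ∨ (v0 = v1 ∧ p0.l = p1.l) := by
      rcases lt_trichotomy v0.length v1.length with h | h | h
      · exact Or.inl h
      · exact Or.inr (prefix_unique hv0 hv1 h)
      · exfalso
        have g1 : v1 ++ [p1.l] <+: v0 := by
          refine List.prefix_of_prefix_length_le hv1 ((List.prefix_append v0 [p0.l]).trans hv0) ?_
          simp; omega
        obtain ⟨t, rfl⟩ := g1
        have := ht1.length_le
        rw [he0, he1] at hlt
        simp at hlt this
        omega
    refine ⟨p0, hp0, p1, hp1, p2, hp2, p3, hp3, decide (v0.length = v1.length), ?_,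
      v0, v1, v2, v3, hv0, hv1, hv2, hv3, ?_, ?_, ?_, ?_⟩
    · rcases key with h | ⟨h, h'⟩
      · rw [decide_eq_false (by omega)]; rfl
      · subst h
        rw [decide_eq_true rfl]
        simp only [allow, Bool.and_eq_true, decide_eq_true_eq]
        refine ⟨h', ?_⟩
        rw [he0, he1] at hlt
        simp at hlt
        omega
    · rw [hs0, hs1, hs2, nxt3_dd]
    · rw [hs1, hs2, hs3, nxt3_dd]
    · intro h
      exact (prefix_unique hv0 hv1 (by simpa using h)).1
    · intro h
      rcases key with h' | ⟨h', -⟩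
      · exact h'
      · simp [h'] at h

theorem safe_zero (n : ℕ) : safe n true .a .a .a .a zero zero = false := by
  induction n with
  | zero => rfl
  | succ n ih =>
    by_contra hc
    rw [Bool.not_eq_false] at hc
    unfold safe at hc
    have c1 : ok1 .a .a .a zero = true := by decide +kernel
    have c2 : ok2 .a .a .a .a (zero.add zero) = true := by decide +kernel
    rw [c1, c2] at hc
    simp only [Bool.not_true, Bool.false_or, Bool.false_and, List.all_eq_true, Bool.or_eq_true] at hc
    have m : (⟨.a, 0, 0⟩ : Par) ∈ Q .a := by simp [Q]
    rcases hc _ m _ m _ m with h | h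
    · revert h; decide +kernel
    · rcases h _ m true (by simp) with h | h
      · revert h; decide +kernel
      · exact absurd h (by
          have e : nxt3 zero ⟨.a, 0, 0⟩ ⟨.a, 0, 0⟩ ⟨.a, 0, 0⟩ = zero := by
            simp [nxt3, nxt, zero]
          simp only [e, ih]; simp)

theorem isZ_iff (D : V4_s2) : isZ D = true ↔ D = zero := by
  cases D; simp [isZ, zero, and_assoc]

theorem mem_lts (l : Lt) : l ∈ lts := by cases l <;> simp [lts]

theorem not_safe (hok1 : ∀ k l0 l1 l2 u0 u1 u2, u0 ++ [l0] <+: W k → u1 ++ [l1] <+: W k →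
      u2 ++ [l2] <+: W k → ok1 l0 l1 l2 (dd (psi u0) (psi u1) (psi u2)) = true)
    (hok2 : ∀ k l0 l1 l2 l3 u0 u1 u2 u3, u0 ++ [l0] <+: W k → u1 ++ [l1] <+: W k →
      u2 ++ [l2] <+: W k → u3 ++ [l3] <+: W k →
      ok2 l0 l1 l2 l3 ((dd (psi u0) (psi u1) (psi u2)).add (dd (psi u1) (psi u2) (psi u3))) = true)
    (k : ℕ) : ∀ (n : ℕ) (f : Bool) (l0 l1 l2 l3 : Lt) (D1 D2 : V4_s2),
      Real k f l0 l1 l2 l3 D1 D2 → safe n f l0 l1 l2 l3 D1 D2 = false := by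
  have R1 : ∀ {k f l0 l1 l2 l3 D1 D2}, Real k f l0 l1 l2 l3 D1 D2 →
      ok1 l0 l1 l2 D1 = true ∧ ok1 l1 l2 l3 D2 = true ∧ ok2 l0 l1 l2 l3 (D1.add D2) = true := by
    rintro k f l0 l1 l2 l3 D1 D2 ⟨u0, u1, u2, u3, h0, h1, h2, h3, rfl, rfl, -, -⟩
    exact ⟨hok1 k _ _ _ _ _ _ h0 h1 h2, hok1 k _ _ _ _ _ _ h1 h2 h3,
      hok2 k _ _ _ _ _ _ _ _ h0 h1 h2 h3⟩
  induction k with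
  | zero =>
    rintro n f l0 l1 l2 l3 D1 D2 ⟨u0, u1, u2, u3, h0, h1, h2, h3, rfl, rfl, hf, hf'⟩
    have aux : ∀ (u : List Lt) (l : Lt), u ++ [l] <+: W 0 → u = [] ∧ l = .a := by
      intro u l h
      exact prefix_unique (u := u) (v := []) h (by simp [W]) (by
        have := h.length_le; simp [W] at this; simp [this])
    obtain ⟨rfl, rfl⟩ := aux _ _ h0
    obtain ⟨rfl, rfl⟩ := aux _ _ h1
    obtain ⟨rfl, rfl⟩ := aux _ _ h2
    obtain ⟨rfl, rfl⟩ := aux _ _ h3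
    cases f with
    | false => simp at hf'
    | true =>
      have := safe_zero n
      simpa [dd, psi, zero] using this
  | succ k ih =>
    intro n f l0 l1 l2 l3 D1 D2 hR
    cases n with
    | zero => rfl
    | succ n =>
      obtain ⟨o1, o2, o3⟩ := R1 hR
      obtain ⟨p0, hp0, p1, hp1, p2, hp2, p3, hp3, f', ha, hR'⟩ := step k f l0 l1 l2 l3 D1 D2 hR
      obtain ⟨o1', -, -⟩ := R1 hR'
      by_contra hc
      rw [Bool.not_eq_false] at hc
      unfold safe at hc
      rw [o1, o2, o3] at hc
      simp only [Bool.not_true, Bool.false_or, List.all_eq_true, Bool.or_eq_true,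
        Bool.and_eq_true, isZ_iff] at hc
      have hm : f' ∈ [true, false] := by cases f' <;> simp
      rcases hc with ⟨hf, rfl, rfl⟩ | hc
      · have hz := zero_closed
        simp only [List.all_eq_true] at hz
        have := hz _ (mem_lts l0) _ (mem_lts l1) _ (mem_lts l2) _ (mem_lts l3)
        simp only [par1, List.all_eq_true] at this
        have := this _ hp0 _ hp1 _ hp2 _ hp3 _ hm
        have hf2 : f = false := by simpa using hf
        subst hf2
        rw [ha, ih _ _ _ _ _ _ _ _ hR'] at this
        simp at this
      · have := hc _ hp0 _ hp1 _ hp2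
        rw [o1'] at this
        simp only [Bool.not_true, Bool.false_eq_true, false_or] at this
        have := this _ hp3 _ hm
        rw [ha, ih _ _ _ _ _ _ _ _ hR'] at this
        simp at this

/-! ### The contracting eigenvalue -/

theorem root_aux : ∃ x y : ℝ, 0.40739195 ≤ x ∧ x ≤ 0.40739197 ∧ 0.47656531 ≤ y ∧ y ≤ 0.47656534 ∧
    ((⟨x, y⟩ : ℂ) ^ 4 - (⟨x, y⟩ : ℂ) ^ 3 - 2 * (⟨x, y⟩ : ℂ) ^ 2 + 2 * (⟨x, y⟩ : ℂ) - 1 = 0) := by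
  have hcont : Continuous (fun x : ℝ => x ^ 4 - x ^ 3 - 2 * x ^ 2 + 2 * x - 1) := by fun_prop
  obtain ⟨r, ⟨hr1, hr2⟩, hr⟩ := intermediate_value_Icc
    (show (1.690284494 : ℝ) ≤ 1.690284495 by norm_num) hcont.continuousOn
    (show (0 : ℝ) ∈ _ from ⟨by norm_num, by norm_num⟩)
  obtain ⟨q, ⟨hq1, hq2⟩, hq⟩ := intermediate_value_Icc'
    (show (-1.505068414 : ℝ) ≤ -1.505068413 by norm_num) hcont.continuousOn
    (show (0 : ℝ) ∈ _ from ⟨by norm_num, by norm_num⟩)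
  simp only at hr hq
  obtain ⟨s, hs⟩ : ∃ s, s = 1 - r - q := ⟨_, rfl⟩
  obtain ⟨t, ht⟩ : ∃ t, t = r ^ 2 + r * q + q ^ 2 - r - q - 2 := ⟨_, rfl⟩
  have hrem : q ^ 3 + (r - 1) * q ^ 2 + (r ^ 2 - r - 2) * q + (r ^ 3 - r ^ 2 - 2 * r + 2) = 0 := by
    have h1 : q - r ≠ 0 := by
      intro h
      norm_num at hr1 hq2
      linarith
    apply mul_left_cancel₀ h1
    linear_combination hq - hr
  have hs1 : 0.81478391 ≤ s := by rw [hs]; norm_num at *; linarith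
  have hs2 : s ≤ 0.81478393 := by rw [hs]; norm_num at *; linarith
  have ht1 : 0.39308270 ≤ t := by rw [ht]; norm_num at *; nlinarith
  have ht2 : t ≤ 0.39308273 := by rw [ht]; norm_num at *; nlinarith
  have hD : 0 ≤ t - s ^ 2 / 4 := by norm_num at *; nlinarith
  have hy := Real.sq_sqrt hD
  refine ⟨s / 2, √(t - s ^ 2 / 4), by norm_num at *; linarith, by norm_num at *; linarith, ?_, ?_, ?_⟩
  · apply Real.le_sqrt_of_sq_le
    norm_num at *; nlinarith
  · rw [Real.sqrt_le_iff]
    refine ⟨by norm_num, ?_⟩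
    norm_num at *; nlinarith
  · set y := √(t - s ^ 2 / 4)
    set z : ℂ := ⟨s / 2, y⟩ with hz
    have hz2 : z ^ 2 - s * z + t = 0 := by
      apply Complex.ext
      · simp [hz, pow_two]; linarith
      · simp [hz, pow_two]; ring
    have hr' : (r : ℂ) ^ 4 - r ^ 3 - 2 * r ^ 2 + 2 * r - 1 = 0 := by exact_mod_cast hr
    have hrem' : (q : ℂ) ^ 3 + (r - 1) * q ^ 2 + (r ^ 2 - r - 2) * q + (r ^ 3 - r ^ 2 - 2 * r + 2) = 0 := by
      exact_mod_cast hrem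
    have hs' : (s : ℂ) = 1 - r - q := by exact_mod_cast hs
    have ht' : (t : ℂ) = r ^ 2 + r * q + q ^ 2 - r - q - 2 := by exact_mod_cast ht
    rw [hs', ht'] at hz2
    linear_combination (z - r) * (z - q) * hz2 + (z - r) * hrem' + hr'

noncomputable def lx : ℝ := Classical.choose root_aux
noncomputable def ly : ℝ := Classical.choose (Classical.choose_spec root_aux)

theorem lspec : 0.40739195 ≤ lx ∧ lx ≤ 0.40739197 ∧ 0.47656531 ≤ ly ∧ ly ≤ 0.47656534 ∧
    ((⟨lx, ly⟩ : ℂ) ^ 4 - (⟨lx, ly⟩ : ℂ) ^ 3 - 2 * (⟨lx, ly⟩ : ℂ) ^ 2 + 2 * (⟨lx, ly⟩ : ℂ) - 1 = 0) :=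
  Classical.choose_spec (Classical.choose_spec root_aux)

noncomputable def lam : ℂ := ⟨lx, ly⟩

noncomputable def vd (D : V4_s2) : ℂ :=
  D.a + D.b * (lam ^ 2 - lam) + D.c * (lam - 1) + D.d * (lam ^ 3 - lam ^ 2 - lam + 1)

theorem vd_mul (D : V4_s2) (ea ed : ℤ) :
    vd (mul D ea ed) = lam * vd D + (ea + ed * (lam ^ 3 - lam ^ 2 - lam + 1)) := by
  have h : lam ^ 4 - lam ^ 3 - 2 * lam ^ 2 + 2 * lam - 1 = 0 := lspec.2.2.2.2
  simp only [vd, mul]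
  push_cast
  linear_combination (-(D.d : ℂ)) * h

theorem vd_dd (x y z : V4_s2) : vd (dd x y z) = vd z - 2 * vd y + vd x := by
  simp only [vd, dd]; push_cast; ring

theorem vd_add (x y : V4_s2) : vd (x.add y) = vd x + vd y := by
  simp only [vd, V4_s2.add]; push_cast; ring

theorem norm_le_of {z : ℂ} {A B r : ℝ} (hr : 0 ≤ r) (h1 : |z.re| ≤ A) (h2 : |z.im| ≤ B)
    (h : A ^ 2 + B ^ 2 ≤ r ^ 2) : ‖z‖ ≤ r := by
  refine (sq_le_sq₀ (norm_nonneg _) hr).1 ?_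
  rw [Complex.sq_norm, Complex.normSq_apply]
  have := sq_le_sq' (abs_le.1 h1).1 (abs_le.1 h1).2
  have := sq_le_sq' (abs_le.1 h2).1 (abs_le.1 h2).2
  nlinarith

theorem pmul {x y a c b d : ℝ} (ha : 0 ≤ a) (hc : 0 ≤ c) (h1 : a ≤ x) (h2 : x ≤ b) (h3 : c ≤ y)
    (h4 : y ≤ d) : a * c ≤ x * y ∧ x * y ≤ b * d :=
  ⟨mul_le_mul h1 h3 hc (ha.trans h1), mul_le_mul h2 h4 (hc.trans h3) (ha.trans (h1.trans h2))⟩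

theorem lam_re : lam.re = lx := rfl
theorem lam_im : lam.im = ly := rfl

theorem v1_bounds : |(lam ^ 2 - lam).re + 0.46853826| ≤ 0.000001 ∧
    |(lam ^ 2 - lam).im + 0.08826756| ≤ 0.000001 := by
  obtain ⟨x1, x2, y1, y2, -⟩ := lspec
  have a1 := pmul (by norm_num) (by norm_num) x1 x2 x1 x2
  have a2 := pmul (by norm_num) (by norm_num) x1 x2 y1 y2
  have a3 := pmul (by norm_num) (by norm_num) y1 y2 y1 y2
  simp only [pow_two, Complex.sub_re, Complex.sub_im, Complex.mul_re, Complex.mul_im, lam_re, lam_im,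
    abs_le]
  norm_num at *
  refine ⟨⟨?_, ?_⟩, ?_, ?_⟩ <;> linarith

theorem v4_bounds : |(lam ^ 3 - lam ^ 2 - lam + 1).re - 0.44379458| ≤ 0.000001 ∧
    |(lam ^ 3 - lam ^ 2 - lam + 1).im + 0.73581391| ≤ 0.000001 := by
  obtain ⟨x1, x2, y1, y2, -⟩ := lspec
  have a1 := pmul (by norm_num) (by norm_num) x1 x2 x1 x2
  have a2 := pmul (by norm_num) (by norm_num) x1 x2 y1 y2
  have a3 := pmul (by norm_num) (by norm_num) y1 y2 y1 y2
  have b1 := pmul (by norm_num) (by norm_num) a1.1 a1.2 x1 x2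
  have b2 := pmul (by norm_num) (by norm_num) a1.1 a1.2 y1 y2
  have b3 := pmul (by norm_num) (by norm_num) a3.1 a3.2 x1 x2
  have b4 := pmul (by norm_num) (by norm_num) a3.1 a3.2 y1 y2
  have e1 : (lam ^ 3 - lam ^ 2 - lam + 1).re
      = lx * lx * lx - 3 * (ly * ly * lx) - (lx * lx - ly * ly) - lx + 1 := by
    simp [pow_succ, lam_re, lam_im]; ring
  have e2 : (lam ^ 3 - lam ^ 2 - lam + 1).im
      = 3 * (lx * lx * ly) - ly * ly * ly - 2 * (lx * ly) - ly := by
    simp [pow_succ, lam_re, lam_im]; ring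
  rw [e1, e2, abs_le, abs_le]
  norm_num at *
  refine ⟨⟨?_, ?_⟩, ?_, ?_⟩ <;> linarith

theorem norm_lam : ‖lam‖ ≤ 0.626964 := by
  obtain ⟨x1, x2, y1, y2, -⟩ := lspec
  apply norm_le_of (A := 0.40739197) (B := 0.47656534) (by norm_num)
  · rw [lam_re, abs_le]; constructor <;> norm_num at * <;> linarith
  · rw [lam_im, abs_le]; constructor <;> norm_num at * <;> linarith
  · norm_num

/-- Exact centre of the disc of a letter. -/
noncomputable def ctr (l : Lt) : ℂ := ⟨cx l, cy l⟩

theorem trans_bound (l : Lt) (p : Par) (hp : p ∈ Q l) :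
    ‖lam * ctr p.l + 10000 * (p.ea + p.ed * (lam ^ 3 - lam ^ 2 - lam + 1)) - ctr l‖
      ≤ rad l - 0.626964 * rad p.l := by
  obtain ⟨x1, x2, y1, y2, -⟩ := lspec
  obtain ⟨w1, w2⟩ := v4_bounds
  obtain ⟨z, hz⟩ : ∃ z, z = lam ^ 3 - lam ^ 2 - lam + 1 := ⟨_, rfl⟩
  rw [← hz] at w1 w2 ⊢
  rw [abs_le] at w1 w2
  obtain ⟨w1, w1'⟩ := w1
  obtain ⟨w2, w2'⟩ := w2
  have key : ∀ (c1 c2 d1 d2 e1 e2 r A0 B0 : ℝ), 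
      |lx * c1 - ly * c2 + 10000 * (e1 + e2 * z.re) - d1| ≤ A0 →
      |lx * c2 + ly * c1 + 10000 * (e2 * z.im) - d2| ≤ B0 →
      0 ≤ r → A0 ^ 2 + B0 ^ 2 ≤ r ^ 2 →
      ‖lam * (⟨c1, c2⟩ : ℂ) + 10000 * ((e1 : ℂ) + (e2 : ℂ) * z) - ⟨d1, d2⟩‖ ≤ r := by
    intro c1 c2 d1 d2 e1 e2 r A0 B0 h1 h2 h3 h4
    refine norm_le_of (A := A0) (B := B0) h3 ?_ ?_ h4
    · simpa [lam_re, lam_im] using h1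
    · simpa [lam_re, lam_im] using h2
  have e : lam * ctr p.l + 10000 * (p.ea + p.ed * z) - ctr l =
    lam * (⟨(cx p.l : ℝ), (cy p.l : ℝ)⟩ : ℂ) + 10000 * (((p.ea : ℝ) : ℂ) + ((p.ed : ℝ) : ℂ) * z)
      - ⟨(cx l : ℝ), (cy l : ℝ)⟩ := by simp [ctr]
  rw [e]
  cases l <;> simp only [Q, List.mem_cons, List.not_mem_nil, or_false] at hp
  · rcases hp with rfl | rfl
    · refine key _ _ _ _ _ _ _ 68.6 1092.7 ?_ ?_ ?_ ?_ <;> simp only [cx, cy, rad, abs_le] <;> norm_num at * <;>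
        (try constructor) <;> linarith
    · refine key _ _ _ _ _ _ _ 448.3 1062.6 ?_ ?_ ?_ ?_ <;> simp only [cx, cy, rad, abs_le] <;> norm_num at * <;>
        (try constructor) <;> linarith
  · rcases hp with rfl | rfl
    · refine key _ _ _ _ _ _ _ 1313.5 243.4 ?_ ?_ ?_ ?_ <;> simp only [cx, cy, rad, abs_le] <;> norm_num at * <;>
        (try constructor) <;> linarith
    · refine key _ _ _ _ _ _ _ 2684.7 595.4 ?_ ?_ ?_ ?_ <;> simp only [cx, cy, rad, abs_le] <;> norm_num at * <;>
        (try constructor) <;> linarith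
  · rcases hp with rfl | rfl
    · refine key _ _ _ _ _ _ _ 1342.6 2967.3 ?_ ?_ ?_ ?_ <;> simp only [cx, cy, rad, abs_le] <;> norm_num at * <;>
        (try constructor) <;> linarith
    · refine key _ _ _ _ _ _ _ 2212.2 444.7 ?_ ?_ ?_ ?_ <;> simp only [cx, cy, rad, abs_le] <;> norm_num at * <;>
        (try constructor) <;> linarith
  · subst hp
    refine key _ _ _ _ _ _ _ 1.2 1.4 ?_ ?_ ?_ ?_ <;> simp only [cx, cy, rad, abs_le] <;> norm_num at * <;>
      (try constructor) <;> linarith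

theorem disc_bound (k : ℕ) : ∀ (u : List Lt) (l : Lt), u ++ [l] <+: W k →
    ‖10000 * vd (psi u) - ctr l‖ ≤ rad l := by
  induction k with
  | zero =>
    intro u l h
    obtain ⟨rfl, rfl⟩ := prefix_unique (u := u) (v := []) (m := .a) h (by simp [W]) (by
        have := h.length_le; simp [W] at this; simp [this])
    apply norm_le_of (A := 969) (B := 1063) <;> simp [psi, vd, ctr, cx, cy, rad] <;> norm_num
  | succ k ih =>
    intro u l h
    obtain ⟨u', pre, p, hp, hv, -, -, -, hs⟩ := desub1 k u l h
    have h1 := ih u' p.l hv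
    have h2 := trans_bound l p hp
    rw [hs, vd_mul]
    have e : 10000 * (lam * vd (psi u') + (p.ea + p.ed * (lam ^ 3 - lam ^ 2 - lam + 1))) - ctr l
      = lam * (10000 * vd (psi u') - ctr p.l) +
        (lam * ctr p.l + 10000 * (p.ea + p.ed * (lam ^ 3 - lam ^ 2 - lam + 1)) - ctr l) := by ring
    rw [e]
    refine (norm_add_le _ _).trans ?_
    rw [norm_mul]
    have h3 : ‖lam‖ * ‖10000 * vd (psi u') - ctr p.l‖ ≤ 0.626964 * rad p.l :=
      mul_le_mul norm_lam h1 (norm_nonneg _) (by norm_num)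
    linarith

theorem approx (D : V4_s2) :
    ‖10000 * vd D - (⟨10000 * D.a - 4685 * D.b - 5926 * D.c + 4438 * D.d,
      -883 * D.b + 4766 * D.c - 7358 * D.d⟩ : ℂ)‖ ≤
      (D.a.natAbs + D.b.natAbs + D.c.natAbs + D.d.natAbs : ℕ) := by
  obtain ⟨x1, x2, y1, y2, -⟩ := lspec
  obtain ⟨w1, w2⟩ := v4_bounds
  obtain ⟨t1, t2⟩ := v1_bounds
  rw [abs_le] at w1 w2 t1 t2
  have n1 : ‖10000 * (lam ^ 2 - lam) - (⟨-4685, -883⟩ : ℂ)‖ ≤ 1 := by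
    obtain ⟨z, hz⟩ : ∃ z, z = lam ^ 2 - lam := ⟨_, rfl⟩
    rw [← hz] at t1 t2 ⊢
    apply norm_le_of (A := 0.7) (B := 0.7) <;> simp [abs_le] <;> norm_num at *
    all_goals constructor <;> linarith
  have n2 : ‖10000 * (lam - 1) - (⟨-5926, 4766⟩ : ℂ)‖ ≤ 1 := by
    apply norm_le_of (A := 0.7) (B := 0.7) <;> simp [abs_le, lam_re, lam_im] <;> norm_num at *
    all_goals constructor <;> linarith
  have n3 : ‖10000 * (lam ^ 3 - lam ^ 2 - lam + 1) - (⟨4438, -7358⟩ : ℂ)‖ ≤ 1 := by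
    obtain ⟨z, hz⟩ : ∃ z, z = lam ^ 3 - lam ^ 2 - lam + 1 := ⟨_, rfl⟩
    rw [← hz] at w1 w2 ⊢
    apply norm_le_of (A := 0.7) (B := 0.7) <;> simp [abs_le] <;> norm_num at *
    all_goals constructor <;> linarith
  have e : 10000 * vd D - (⟨10000 * D.a - 4685 * D.b - 5926 * D.c + 4438 * D.d,
      -883 * D.b + 4766 * D.c - 7358 * D.d⟩ : ℂ) =
      (D.b : ℂ) * (10000 * (lam ^ 2 - lam) - (⟨-4685, -883⟩ : ℂ)) +
      (D.c : ℂ) * (10000 * (lam - 1) - (⟨-5926, 4766⟩ : ℂ)) +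
      (D.d : ℂ) * (10000 * (lam ^ 3 - lam ^ 2 - lam + 1) - (⟨4438, -7358⟩ : ℂ)) := by
    have h0 : ∀ x y : ℝ, (⟨x, y⟩ : ℂ) = x + y * Complex.I := by
      intro x y; apply Complex.ext <;> simp
    simp only [h0, vd]
    push_cast
    ring
  rw [e]
  have hn : ∀ n : ℤ, ‖(n : ℂ)‖ = (n.natAbs : ℝ) := by
    intro n; rw [Complex.norm_intCast, Nat.cast_natAbs, Int.cast_abs]
  have m : ∀ (n : ℤ) (z : ℂ), ‖z‖ ≤ 1 → ‖(n : ℂ) * z‖ ≤ (n.natAbs : ℝ) := by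
    intro n z hz
    rw [norm_mul, hn]
    exact mul_le_of_le_one_right (by positivity) hz
  have := norm_add₃_le (a := (D.b : ℂ) * (10000 * (lam ^ 2 - lam) - (⟨-4685, -883⟩ : ℂ)))
    (b := (D.c : ℂ) * (10000 * (lam - 1) - (⟨-5926, 4766⟩ : ℂ)))
    (c := (D.d : ℂ) * (10000 * (lam ^ 3 - lam ^ 2 - lam + 1) - (⟨4438, -7358⟩ : ℂ)))
  have g1 := m D.b _ n1
  have g2 := m D.c _ n2
  have g3 := m D.d _ n3
  have g0 : (0 : ℝ) ≤ (D.a.natAbs : ℝ) := by positivity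
  rw [Nat.cast_add, Nat.cast_add, Nat.cast_add]
  linarith

theorem disc_iff (D : V4_s2) (x y r : ℤ) : disc D x y r = true ↔
    (10000 * D.a - 4685 * D.b - 5926 * D.c + 4438 * D.d - x) *
    (10000 * D.a - 4685 * D.b - 5926 * D.c + 4438 * D.d - x) +
    (-883 * D.b + 4766 * D.c - 7358 * D.d - y) * (-883 * D.b + 4766 * D.c - 7358 * D.d - y) ≤
    (r + (D.a.natAbs + D.b.natAbs + D.c.natAbs + D.d.natAbs : ℕ)) *
    (r + (D.a.natAbs + D.b.natAbs + D.c.natAbs + D.d.natAbs : ℕ)) := by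
  simp only [disc, decide_eq_true_eq]

theorem disc_true (D : V4_s2) (x y r : ℤ) (h : ‖10000 * vd D - (⟨x, y⟩ : ℂ)‖ ≤ r) :
    disc D x y r = true := by
  have h1 := approx D
  have h2 : ‖(⟨10000 * D.a - 4685 * D.b - 5926 * D.c + 4438 * D.d - x,
      -883 * D.b + 4766 * D.c - 7358 * D.d - y⟩ : ℂ)‖ ≤
      r + (D.a.natAbs + D.b.natAbs + D.c.natAbs + D.d.natAbs : ℕ) := by
    have e : (⟨10000 * D.a - 4685 * D.b - 5926 * D.c + 4438 * D.d - x,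
      -883 * D.b + 4766 * D.c - 7358 * D.d - y⟩ : ℂ) = (10000 * vd D - (⟨x, y⟩ : ℂ)) -
      (10000 * vd D - (⟨10000 * D.a - 4685 * D.b - 5926 * D.c + 4438 * D.d,
      -883 * D.b + 4766 * D.c - 7358 * D.d⟩ : ℂ)) := by
      apply Complex.ext <;> simp
    rw [e]
    exact (norm_sub_le _ _).trans (add_le_add h h1)
  have h3 := pow_le_pow_left₀ (norm_nonneg _) h2 2
  rw [Complex.sq_norm, Complex.normSq_apply, pow_two] at h3
  dsimp only at h3
  rw [disc_iff]
  generalize D.a.natAbs + D.b.natAbs + D.c.natAbs + D.d.natAbs = m at *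
  rw [← Int.cast_le (R := ℝ)]
  push_cast
  exact h3

theorem ok1_real (k : ℕ) (l0 l1 l2 : Lt) (u0 u1 u2 : List Lt) (h0 : u0 ++ [l0] <+: W k)
    (h1 : u1 ++ [l1] <+: W k) (h2 : u2 ++ [l2] <+: W k) :
    ok1 l0 l1 l2 (dd (psi u0) (psi u1) (psi u2)) = true := by
  apply disc_true
  have g0 := disc_bound k _ _ h0
  have g1 := disc_bound k _ _ h1
  have g2 := disc_bound k _ _ h2
  rw [vd_dd]
  have e : (10000 * (vd (psi u2) - 2 * vd (psi u1) + vd (psi u0)) -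
      (⟨(cx l2 - 2 * cx l1 + cx l0 : ℤ), (cy l2 - 2 * cy l1 + cy l0 : ℤ)⟩ : ℂ)) =
      (10000 * vd (psi u2) - ctr l2) + (-((10000 * vd (psi u1) - ctr l1) +
      (10000 * vd (psi u1) - ctr l1))) + (10000 * vd (psi u0) - ctr l0) := by
    apply Complex.ext <;> simp [ctr] <;> ring
  rw [e]
  refine norm_add₃_le.trans ?_
  rw [norm_neg]
  have := norm_add_le (10000 * vd (psi u1) - ctr l1) (10000 * vd (psi u1) - ctr l1)
  push_cast
  linarith

theorem ok2_real (k : ℕ) (l0 l1 l2 l3 : Lt) (u0 u1 u2 u3 : List Lt) (h0 : u0 ++ [l0] <+: W k)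
    (h1 : u1 ++ [l1] <+: W k) (h2 : u2 ++ [l2] <+: W k) (h3 : u3 ++ [l3] <+: W k) :
    ok2 l0 l1 l2 l3 ((dd (psi u0) (psi u1) (psi u2)).add (dd (psi u1) (psi u2) (psi u3)))
      = true := by
  apply disc_true
  have g0 := disc_bound k _ _ h0
  have g1 := disc_bound k _ _ h1
  have g2 := disc_bound k _ _ h2
  have g3 := disc_bound k _ _ h3
  rw [vd_add, vd_dd, vd_dd]
  have e : (10000 * (vd (psi u2) - 2 * vd (psi u1) + vd (psi u0) +
      (vd (psi u3) - 2 * vd (psi u2) + vd (psi u1))) -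
      (⟨(cx l3 - cx l2 - cx l1 + cx l0 : ℤ), (cy l3 - cy l2 - cy l1 + cy l0 : ℤ)⟩ : ℂ)) =
      (10000 * vd (psi u3) - ctr l3) + (-((10000 * vd (psi u2) - ctr l2) +
      (10000 * vd (psi u1) - ctr l1))) + (10000 * vd (psi u0) - ctr l0) := by
    apply Complex.ext <;> simp [ctr] <;> ring
  rw [e]
  refine norm_add₃_le.trans ?_
  rw [norm_neg]
  have := norm_add_le (10000 * vd (psi u2) - ctr l2) (10000 * vd (psi u1) - ctr l1)
  push_cast
  linarith

/-! ### No additive cube in the finite words -/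

theorem mem_short (l0 l1 l2 : Lt) (x y : ℤ) (h : ok1 l0 l1 l2 (kv x y) = true) :
    (x, y) ∈ short := by
  have hb : (-6 ≤ x ∧ x ≤ 6) ∧ (-4 ≤ y ∧ y ≤ 4) := by
    have h' := h
    rw [ok1, disc_iff] at h'
    simp only [kv] at h'
    obtain ⟨X, hX⟩ : ∃ X, X = cx l2 - 2 * cx l1 + cx l0 := ⟨_, rfl⟩
    obtain ⟨Y, hY⟩ : ∃ Y, Y = cy l2 - 2 * cy l1 + cy l0 := ⟨_, rfl⟩
    obtain ⟨r, hr⟩ : ∃ r, r = rad l2 + 2 * rad l1 + rad l0 := ⟨_, rfl⟩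
    rw [← hX, ← hY, ← hr] at h'
    have bX : -17500 ≤ X ∧ X ≤ 17500 := by
      rw [hX]; cases l0 <;> cases l1 <;> cases l2 <;> simp [cx]
    have bY : -14000 ≤ Y ∧ Y ≤ 14000 := by
      rw [hY]; cases l0 <;> cases l1 <;> cases l2 <;> simp [cy]
    have br : 0 ≤ r ∧ r ≤ 21000 := by
      rw [hr]; cases l0 <;> cases l1 <;> cases l2 <;> simp [rad]
    clear hX hY hr
    obtain ⟨s, hs⟩ : ∃ s : ℤ, s = r + ((2 * x + 3 * y).natAbs + (-3 * x - 4 * y).natAbs +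
      x.natAbs + y.natAbs : ℕ) := ⟨_, rfl⟩
    rw [← hs] at h'
    have s0 : 0 ≤ s := by omega
    obtain ⟨P, hP⟩ : ∃ P, P = 10000 * (2 * x + 3 * y) - 4685 * (-3 * x - 4 * y) - 5926 * x
      + 4438 * y - X := ⟨_, rfl⟩
    obtain ⟨R, hR⟩ : ∃ R, R = -883 * (-3 * x - 4 * y) + 4766 * x - 7358 * y - Y := ⟨_, rfl⟩
    rw [← hP, ← hR] at h'
    have a1 := abs_le_of_sq_le_sq' (a := P) (b := s) (by nlinarith [mul_self_nonneg R]) s0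
    have a2 := abs_le_of_sq_le_sq' (a := R) (b := s) (by nlinarith [mul_self_nonneg P]) s0
    omega
  have hs := short_of_ok
  simp only [List.all_eq_true] at hs
  have hx : x ∈ xs := by simp only [xs, List.mem_cons, List.not_mem_nil, or_false]; omega
  have hy : y ∈ ys := by simp only [ys, List.mem_cons, List.not_mem_nil, or_false]; omega
  have := hs x hx y hy
  simp only [Bool.or_eq_true, List.all_eq_true] at this
  rcases this with h1 | h1
  · simp only [inShort, List.any_eq_true, Bool.and_eq_true, decide_eq_true_eq] at h1
    obtain ⟨⟨p, q⟩, hp, h2, h3⟩ := h1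
    simp only at h2 h3
    rw [← h2, ← h3]
    exact hp
  · have := h1 _ (mem_lts l0) _ (mem_lts l1) _ (mem_lts l2)
    rw [h] at this
    simp at this

/-- Value of a letter. -/
def wt : Lt → ℕ
  | .a => 0
  | .b => 1
  | .c => 3
  | .d => 4

theorem wt_mem (l : Lt) : wt l ∈ ({0, 1, 3, 4} : Set ℕ) := by
  cases l <;> simp [wt]

theorem kv_of (D : V4_s2) (h1 : D.a + D.b + D.c + D.d = 0) (h2 : D.b + 3 * D.c + 4 * D.d = 0) :
    D = kv D.c D.d := by
  obtain ⟨a, b, c, d⟩ := D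
  dsimp only at h1 h2
  have e1 : a = 2 * c + 3 * d := by omega
  have e2 : b = -3 * c - 4 * d := by omega
  rw [e1, e2]
  rfl

theorem sum_psi (w : List Lt) (m : ℕ) (hm : m ≤ w.length) :
    ((∑ j ∈ Finset.range m, wt (w.getD j .a) : ℕ) : ℤ) =
      (psi (w.take m)).b + 3 * (psi (w.take m)).c + 4 * (psi (w.take m)).d ∧
    (m : ℤ) = (psi (w.take m)).a + (psi (w.take m)).b + (psi (w.take m)).c + (psi (w.take m)).d := by
  induction m with
  | zero => simp [psi]
  | succ m ih =>
    obtain ⟨h1, h2⟩ := ih (by omega)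
    have hlt : m < w.length := by omega
    rw [Finset.sum_range_succ, List.take_succ_eq_append_getElem hlt,
      List.getD_eq_getElem _ _ hlt]
    generalize ∑ j ∈ Finset.range m, wt (w.getD j .a) = S at *
    simp only [psi, List.count_append] at *
    cases w[m] <;> simp [wt] <;> omega

theorem prefix_take (w : List Lt) (m : ℕ) (hm : m < w.length) : w.take m ++ [w[m]] <+: w := by
  rw [← List.take_succ_eq_append_getElem hm]
  exact List.take_prefix _ _

theorem no_cube (k i n : ℕ) (hn : 1 ≤ n) (hlen : i + n + n + n < (W k).length)
    (h1 : ∑ j ∈ Finset.range n, wt ((W k).getD (i + j) .a) =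
      ∑ j ∈ Finset.range n, wt ((W k).getD (i + n + j) .a))
    (h2 : ∑ j ∈ Finset.range n, wt ((W k).getD (i + n + j) .a) =
      ∑ j ∈ Finset.range n, wt ((W k).getD (i + n + n + j) .a)) : False := by
  have e1 := Finset.sum_range_add (fun j => wt ((W k).getD j .a)) i n
  have e2 := Finset.sum_range_add (fun j => wt ((W k).getD j .a)) (i + n) n
  have e3 := Finset.sum_range_add (fun j => wt ((W k).getD j .a)) (i + n + n) n
  obtain ⟨s0, t0⟩ := sum_psi (W k) i (by omega)
  obtain ⟨s1, t1⟩ := sum_psi (W k) (i + n) (by omega)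
  obtain ⟨s2, t2⟩ := sum_psi (W k) (i + n + n) (by omega)
  obtain ⟨s3, t3⟩ := sum_psi (W k) (i + n + n + n) (by omega)
  obtain ⟨l0, p0⟩ : ∃ l, (W k).take i ++ [l] <+: W k :=
    ⟨_, prefix_take (W k) i (by omega)⟩
  obtain ⟨l1, p1⟩ : ∃ l, (W k).take (i + n) ++ [l] <+: W k :=
    ⟨_, prefix_take (W k) (i + n) (by omega)⟩
  obtain ⟨l2, p2⟩ : ∃ l, (W k).take (i + n + n) ++ [l] <+: W k :=
    ⟨_, prefix_take (W k) (i + n + n) (by omega)⟩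
  obtain ⟨l3, p3⟩ : ∃ l, (W k).take (i + n + n + n) ++ [l] <+: W k :=
    ⟨_, prefix_take (W k) (i + n + n + n) (by omega)⟩
  have k1 := kv_of (dd (psi ((W k).take i)) (psi ((W k).take (i + n))) (psi ((W k).take (i + n + n))))
    (by simp only [dd]; omega) (by simp only [dd]; omega)
  have k2 := kv_of (dd (psi ((W k).take (i + n))) (psi ((W k).take (i + n + n)))
    (psi ((W k).take (i + n + n + n))))
    (by simp only [dd]; omega) (by simp only [dd]; omega)
  have o1 := ok1_real k _ _ _ _ _ _ p0 p1 p2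
  have o2 := ok1_real k _ _ _ _ _ _ p1 p2 p3
  rw [k1] at o1
  rw [k2] at o2
  have m1 := mem_short _ _ _ _ _ o1
  have m2 := mem_short _ _ _ _ _ o2
  have ht := targets
  simp only [List.all_eq_true] at ht
  have hs := ht _ m1 _ m2 _ (mem_lts l0) _ (mem_lts l1) _ (mem_lts l2) _ (mem_lts l3)
  have hR := not_safe ok1_real ok2_real k 20 false _ _ _ _ _ _ ⟨_, _, _, _, p0, p1, p2, p3, k1.symm,
    k2.symm, by simp, by simp; omega⟩
  rw [hs] at hR
  exact absurd hR (by simp)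

theorem length_W (k : ℕ) : k + 1 ≤ (W k).length ∧ ∃ t, W k = .a :: t := by
  induction k with
  | zero => simp [W]
  | succ k ih =>
    obtain ⟨h, t, ht⟩ := ih
    have hge : ∀ u : List Lt, u.length ≤ (u.flatMap ph).length := by
      intro u
      induction u with
      | nil => simp
      | cons x u ihu =>
        rw [List.flatMap_cons, List.length_append, List.length_cons]
        generalize (u.flatMap ph).length = q at *
        cases x <;> simp [ph] <;> omega
    have := hge t
    rw [ht, List.length_cons] at h
    constructor
    · rw [W, ht, List.flatMap_cons, List.length_append]
      generalize (t.flatMap ph).length = q at *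
      simp [ph]
      omega
    · rw [W, ht, List.flatMap_cons]
      simp [ph]

theorem ultra_const (U : Ultrafilter ℕ) (h : ℕ → Lt) : ∃ l, ∀ᶠ N in (U : Filter ℕ), h N = l := by
  have : ∀ᶠ N in (U : Filter ℕ), h N = .a ∨ h N = .b ∨ h N = .c ∨ h N = .d :=
    Filter.Eventually.of_forall fun N => by cases h N <;> simp
  rw [Ultrafilter.eventually_or, Ultrafilter.eventually_or, Ultrafilter.eventually_or] at this
  rcases this with h | h | h | h <;> exact ⟨_, h⟩

end AddCube

/-- There exists a two-sided infinite word over the alphabet `{0,1,3,4}`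
avoiding additive cubes. -/
theorem exists_two_sided_word_avoiding_additive_cubes :
    ∃ f : ℤ → ℕ, (∀ k : ℤ, f k ∈ ({0, 1, 3, 4} : Set ℕ)) ∧
      ∀ (i : ℤ) (n : ℕ), 1 ≤ n →
        ¬ ((∑ j ∈ Finset.range n, f (i + j) = ∑ j ∈ Finset.range n, f (i + n + j)) ∧
           (∑ j ∈ Finset.range n, f (i + n + j) =
            ∑ j ∈ Finset.range n, f (i + 2 * n + j))) := by
  have hc := fun k : ℤ => AddCube.ultra_const (Filter.hyperfilter ℕ)
    (fun N => (AddCube.W (2 * N)).getD ((N : ℤ) + k).toNat .a)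
  choose F hF using hc
  refine ⟨fun k => AddCube.wt (F k), fun k => AddCube.wt_mem _, ?_⟩
  rintro i n hn ⟨h1, h2⟩
  have hall : ∀ᶠ N in (Filter.hyperfilter ℕ : Filter ℕ), ∀ k ∈ Finset.Ico i (i + 3 * n),
      (AddCube.W (2 * N)).getD ((N : ℤ) + k).toNat .a = F k :=
    (Filter.eventually_all_finset _).2 fun k _ => hF k
  have hlarge : ∀ᶠ N in (Filter.hyperfilter ℕ : Filter ℕ), i.natAbs + 3 * n ≤ N := by
    have := Filter.eventually_ge_atTop (i.natAbs + 3 * n)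
    rw [← Nat.cofinite_eq_atTop] at this
    exact Filter.hyperfilter_le_cofinite this
  obtain ⟨N, hN, hN2⟩ := (hall.and hlarge).exists
  obtain ⟨I, hI⟩ : ∃ I : ℕ, (I : ℤ) = N + i := ⟨((N : ℤ) + i).toNat, by omega⟩
  have hlen := (AddCube.length_W (2 * N)).1
  have conv : ∀ m : ℕ, m < 3 * n → AddCube.wt (F (i + m)) =
      AddCube.wt ((AddCube.W (2 * N)).getD (I + m) .a) := by
    intro m hm
    rw [← hN (i + m) (by rw [Finset.mem_Ico]; omega)]
    congr 2
    omega
  have c0 : ∑ j ∈ Finset.range n, AddCube.wt (F (i + j)) =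
      ∑ j ∈ Finset.range n, AddCube.wt ((AddCube.W (2 * N)).getD (I + j) .a) := by
    refine Finset.sum_congr rfl fun j hj => ?_
    rw [Finset.mem_range] at hj
    exact conv j (by omega)
  have c1 : ∑ j ∈ Finset.range n, AddCube.wt (F (i + n + j)) =
      ∑ j ∈ Finset.range n, AddCube.wt ((AddCube.W (2 * N)).getD (I + n + j) .a) := by
    refine Finset.sum_congr rfl fun j hj => ?_
    rw [Finset.mem_range] at hj
    have := conv (n + j) (by omega)
    rw [show i + (n : ℤ) + j = i + ((n + j : ℕ) : ℤ) by push_cast; ring, this, add_assoc]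
  have c2 : ∑ j ∈ Finset.range n, AddCube.wt (F (i + 2 * n + j)) =
      ∑ j ∈ Finset.range n, AddCube.wt ((AddCube.W (2 * N)).getD (I + n + n + j) .a) := by
    refine Finset.sum_congr rfl fun j hj => ?_
    rw [Finset.mem_range] at hj
    have := conv (n + n + j) (by omega)
    rw [show i + 2 * (n : ℤ) + j = i + ((n + n + j : ℕ) : ℤ) by push_cast; ring, this]
    congr 2
    omega
  simp only [c0, c1, c2] at h1 h2
  exact AddCube.no_cube (2 * N) I n hn (by omega) h1 h2
end
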